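/- arXiv:2201.08107 — 2 statements merged into one kernel-verified Lean document; each statement's English description precedes it below -/
import Mathlib

section
/- Let α* be the unique real number in (−∞, −3·4^{−1/3}) such that the planar system dv/dτ = v·f(v,α*) + z², dz/dτ = z·f(v,α*) admits a solution (v,z) : ℝ → ℝ² with z > 0 everywhere tending to (v₁⁰(α*),0) as τ → −∞ and to (v₃⁰(α*),0) as τ → +∞. Then for every α with α ≤ α* or α ≥ 0, the system ẋ = y, ẏ = −x³ + αx²y + y³ has no nonconstant periodic solution (no limit cycles). -/
open Filter Topology

/-- `f(v,α) = v³ - αv² - 1`. -/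
noncomputable def fcubic (v α : ℝ) : ℝ := v ^ 3 - α * v ^ 2 - 1

/-- The transformed system `dv/dτ = v f(v,α) + z²`, `dz/dτ = z f(v,α)` admits a heteroclinic
solution in the upper half plane, joining the saddle at the smallest root of `f(·,α)` (as
`τ → -∞`) with the saddle at the largest root (as `τ → +∞`). -/
def HasHeteroclinic (α : ℝ) : Prop :=
  ∃ v z : ℝ → ℝ, ∃ v₁ v₃ : ℝ,
    (fcubic v₁ α = 0 ∧ ∀ w : ℝ, fcubic w α = 0 → v₁ ≤ w) ∧
    (fcubic v₃ α = 0 ∧ ∀ w : ℝ, fcubic w α = 0 → w ≤ v₃) ∧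
    (∀ τ : ℝ, HasDerivAt v (v τ * fcubic (v τ) α + (z τ) ^ 2) τ ∧
      HasDerivAt z (z τ * fcubic (v τ) α) τ ∧ 0 < z τ) ∧
    Tendsto (fun τ => (v τ, z τ)) atBot (𝓝 (v₁, 0)) ∧
    Tendsto (fun τ => (v τ, z τ)) atTop (𝓝 (v₃, 0))

/-- `(x,y)` is a solution of `ẋ = y`, `ẏ = -x³ + αx²y + y³`. -/
def IsSolXY (α : ℝ) (x y : ℝ → ℝ) : Prop :=
  ∀ t : ℝ, HasDerivAt x (y t) t ∧
    HasDerivAt y (-(x t) ^ 3 + α * (x t) ^ 2 * y t + (y t) ^ 3) t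

/-- `(x,y)` is periodic with some positive period. -/
def IsPeriodicSol (x y : ℝ → ℝ) : Prop :=
  ∃ T : ℝ, 0 < T ∧ ∀ t : ℝ, x (t + T) = x t ∧ y (t + T) = y t

/-- `(x,y)` is nonconstant. -/
def NonconstSol (x y : ℝ → ℝ) : Prop := ∃ t s : ℝ, (x t, y t) ≠ (x s, y s)

/-- A one-sided Grönwall inequality: nonnegativity persists. -/
theorem nonneg_of_mul_le_deriv {f f' k : ℝ → ℝ} {a b : ℝ}
    (hf : ContinuousOn f (Set.Icc a b))
    (hd : ∀ x ∈ Set.Ioo a b, HasDerivAt f (f' x) x) (hk : ContinuousOn k (Set.Icc a b))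
    (ha : 0 ≤ f a) (h : ∀ x ∈ Set.Ioo a b, f x < 0 → k x * f x ≤ f' x) :
    ∀ x ∈ Set.Icc a b, 0 ≤ f x := by
  intro x₁ hx₁
  by_contra! hneg
  obtain ⟨K, hK⟩ := isCompact_Icc.bddAbove_image hk
  have hKk : ∀ x ∈ Set.Icc a b, k x ≤ K := fun x hx => hK ⟨x, hx, rfl⟩
  have hsub : Set.Icc a x₁ ⊆ Set.Icc a b := Set.Icc_subset_Icc_right hx₁.2
  have hS : IsCompact (Set.Icc a x₁ ∩ f ⁻¹' Set.Ici 0) :=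
    isCompact_Icc.of_isClosed_subset
      ((hf.mono hsub).preimage_isClosed_of_isClosed isClosed_Icc isClosed_Ici)
      Set.inter_subset_left
  obtain ⟨s, ⟨hsI, hs0⟩, hsup⟩ := hS.exists_isGreatest ⟨a, ⟨le_rfl, hx₁.1⟩, ha⟩
  have hs0' : 0 ≤ f s := hs0
  have hlt : s < x₁ := lt_of_le_of_ne hsI.2 (by rintro rfl; exact absurd hs0' (not_le.2 hneg))
  have hneg' : ∀ t ∈ Set.Ioo s x₁, f t < 0 := by
    intro t ht
    by_contra! h0
    exact absurd (hsup ⟨⟨hsI.1.trans ht.1.le, ht.2.le⟩, h0⟩) (not_le.2 ht.1)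
  have hmono : MonotoneOn (fun t => f t * Real.exp (-K * t)) (Set.Icc s x₁) := by
    have hd' : ∀ t ∈ Set.Ioo s x₁, HasDerivAt (fun t => f t * Real.exp (-K * t))
        (f' t * Real.exp (-K * t) + f t * (Real.exp (-K * t) * (-K))) t := by
      intro t ht
      have h1 := hd t ⟨hsI.1.trans_lt ht.1, ht.2.trans_le hx₁.2⟩
      have h2 : HasDerivAt (fun t : ℝ => Real.exp (-K * t)) (Real.exp (-K * t) * (-K)) t := by
        simpa using ((hasDerivAt_id t).const_mul (-K)).exp
      exact h1.mul h2
    refine monotoneOn_of_deriv_nonneg (convex_Icc _ _) ?_ ?_ ?_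
    · refine (hf.mono ?_).mul (by fun_prop)
      exact Set.Icc_subset_Icc hsI.1 hx₁.2
    · intro t ht
      rw [interior_Icc] at ht
      exact (hd' t ht).differentiableAt.differentiableWithinAt
    · intro t ht
      rw [interior_Icc] at ht
      rw [(hd' t ht).deriv]
      have hI : t ∈ Set.Ioo a b := ⟨hsI.1.trans_lt ht.1, ht.2.trans_le hx₁.2⟩
      have h1 := h t hI (hneg' t ht)
      have h2 := hKk t ⟨hI.1.le, hI.2.le⟩
      have h3 := hneg' t ht
      have h4 : 0 ≤ f' t - K * f t := by nlinarith
      have h5 := mul_nonneg h4 (Real.exp_pos (-K * t)).le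
      linarith
  have := hmono ⟨le_rfl, hlt.le⟩ ⟨hlt.le, le_rfl⟩ hlt.le
  have h1 : 0 ≤ f s * Real.exp (-K * s) := mul_nonneg hs0' (Real.exp_pos _).le
  have h2 : f x₁ * Real.exp (-K * x₁) < 0 := mul_neg_of_neg_of_pos hneg (Real.exp_pos _)
  simp only at this
  linarith

/-- A strictly increasing continuous function on a compact interval has a continuous inverse. -/
theorem exists_continuous_inverse {X : ℝ → ℝ} {a b : ℝ} (hab : a ≤ b)
    (hc : ContinuousOn X (Set.Icc a b)) (hm : StrictMonoOn X (Set.Icc a b)) :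
    ∃ T : ℝ → ℝ, Continuous T ∧
      ∀ s ∈ Set.Icc (X a) (X b), T s ∈ Set.Icc a b ∧ X (T s) = s := by
  let p : ℝ → ℝ := fun t => (Set.projIcc a b hab t : ℝ)
  have hpc : Continuous p := continuous_subtype_val.comp continuous_projIcc
  have hpI : ∀ t, p t ∈ Set.Icc a b := fun t => (Set.projIcc a b hab t).2
  have hpid : ∀ t ∈ Set.Icc a b, p t = t := fun t ht => by
    simp only [p, Set.projIcc_of_mem hab ht]
  have hpm : Monotone p := fun s t hst => Set.monotone_projIcc hab hst
  have hpl : ∀ t, t ≤ a → p t = a := fun t ht => by simp only [p, Set.projIcc_of_le_left hab ht]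
  have hpr : ∀ t, b ≤ t → p t = b := fun t ht => by simp only [p, Set.projIcc_of_right_le hab ht]
  let F : ℝ → ℝ := fun t => X (p t) + (t - p t)
  have hFc : Continuous F := (hc.comp_continuous hpc hpI).add (continuous_id.sub hpc)
  have hlip : ∀ s t, s ≤ t → p t - p s ≤ t - s := by
    intro s t hst
    simp only [p, Set.coe_projIcc]
    rcases le_total b t with h1 | h1 <;> rcases le_total b s with h2 | h2 <;>
      simp only [h1, h2, min_eq_left, min_eq_right] <;>
      (rcases max_cases a t with h3 | h3 <;> rcases max_cases a s with h4 | h4 <;>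
       rcases max_cases a b with h5 | h5 <;> linarith)
  have hFm : StrictMono F := by
    intro s t hst
    rcases (hpm hst.le).eq_or_lt with h | h
    · simp only [F, h]; linarith
    · have := hm (hpI s) (hpI t) h
      have := hlip s t hst.le
      simp only [F]; linarith
  have hFs : Function.Surjective F := by
    refine hFc.surjective ?_ ?_
    · refine tendsto_atTop.2 fun c => ?_
      filter_upwards [eventually_ge_atTop b, eventually_ge_atTop (c - X b + b)] with t h1 h2
      simp only [F, hpr t h1]; linarith
    · refine tendsto_atBot.2 fun c => ?_
      filter_upwards [eventually_le_atBot a, eventually_le_atBot (c - X a + a)] with t h1 h2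
      simp only [F, hpl t h1]; linarith
  let e := hFm.orderIsoOfSurjective F hFs
  refine ⟨e.symm, e.symm.continuous, fun s hs => ?_⟩
  obtain ⟨t, ht, rfl⟩ := intermediate_value_Icc hab hc hs
  have hFt : e t = X t := by
    change F t = X t
    simp only [F, hpid t ht]; ring
  have : e.symm (X t) = t := by rw [← hFt, OrderIso.symm_apply_apply]
  rw [this]
  exact ⟨ht, rfl⟩

/-- The inverse of a function with positive derivative, with its own derivative. -/
theorem exists_inverse_hasDerivAt {X X' : ℝ → ℝ} {a b : ℝ} (hab : a ≤ b)
    (hc : ContinuousOn X (Set.Icc a b)) (hd : ∀ t ∈ Set.Ioo a b, HasDerivAt X (X' t) t)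
    (hpos : ∀ t ∈ Set.Ioo a b, 0 < X' t) :
    ∃ T : ℝ → ℝ, Continuous T ∧
      (∀ s ∈ Set.Icc (X a) (X b), T s ∈ Set.Icc a b ∧ X (T s) = s) ∧
      ∀ s ∈ Set.Ioo (X a) (X b), T s ∈ Set.Ioo a b ∧ HasDerivAt T (X' (T s))⁻¹ s := by
  have hm : StrictMonoOn X (Set.Icc a b) := by
    refine strictMonoOn_of_deriv_pos (convex_Icc a b) hc fun t ht => ?_
    rw [interior_Icc] at ht
    rw [(hd t ht).deriv]
    exact hpos t ht
  obtain ⟨T, hT, hTs⟩ := exists_continuous_inverse hab hc hm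
  refine ⟨T, hT, hTs, fun s hs => ?_⟩
  obtain ⟨h1, h2⟩ := hTs s (Set.Ioo_subset_Icc_self hs)
  have h3 : T s ∈ Set.Ioo a b := by
    refine ⟨lt_of_le_of_ne h1.1 fun h => ?_, lt_of_le_of_ne h1.2 fun h => ?_⟩
    · rw [← h] at h2; exact hs.1.ne h2
    · rw [h] at h2; exact hs.2.ne' h2
  refine ⟨h3, HasDerivAt.of_local_left_inverse hT.continuousAt (hd _ h3) (hpos _ h3).ne' ?_⟩
  filter_upwards [Ioo_mem_nhds hs.1 hs.2] with r hr
  exact (hTs r (Set.Ioo_subset_Icc_self hr)).2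

/-- A connection of `v' = v f(v) + z²`, `z' = z f(v)` from `(v₁,0)` to `(v₃,0)` with
`v₁ < 0 < v₃` is a graph over the variable `x = v / z`. -/
theorem exists_graph_of_connection {f v z : ℝ → ℝ} {v₁ v₃ : ℝ}
    (hv : ∀ τ, HasDerivAt v (v τ * f (v τ) + z τ ^ 2) τ)
    (hz : ∀ τ, HasDerivAt z (z τ * f (v τ)) τ) (hp : ∀ τ, 0 < z τ)
    (h₁ : v₁ < 0) (h₃ : 0 < v₃)
    (hvb : Tendsto v atBot (𝓝 v₁)) (hvt : Tendsto v atTop (𝓝 v₃))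
    (hzb : Tendsto z atBot (𝓝 0)) (hzt : Tendsto z atTop (𝓝 0)) :
    ∃ Z : ℝ → ℝ, (∀ x, 0 < Z x ∧ HasDerivAt Z (f (x * Z x)) x) ∧
      Tendsto (fun x => x * Z x) atTop (𝓝 v₃) ∧ Tendsto (fun x => x * Z x) atBot (𝓝 v₁) := by
  let X : ℝ → ℝ := fun τ => v τ / z τ
  have hX : ∀ τ, HasDerivAt X (z τ) τ := by
    intro τ
    refine ((hv τ).div (hz τ) (hp τ).ne').congr_deriv ?_
    have := (hp τ).ne'
    field_simp
    ring
  have hXm : StrictMono X := strictMono_of_deriv_pos fun τ => by rw [(hX τ).deriv]; exact hp τ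
  have hXc : Continuous X := continuous_iff_continuousAt.2 fun τ => (hX τ).continuousAt
  have hzb' : Tendsto (fun τ => (z τ)⁻¹) atBot atTop :=
    (tendsto_nhdsWithin_iff.2 ⟨hzb, Eventually.of_forall hp⟩ :
      Tendsto z atBot (𝓝[>] 0)).inv_tendsto_nhdsGT_zero
  have hzt' : Tendsto (fun τ => (z τ)⁻¹) atTop atTop :=
    (tendsto_nhdsWithin_iff.2 ⟨hzt, Eventually.of_forall hp⟩ :
      Tendsto z atTop (𝓝[>] 0)).inv_tendsto_nhdsGT_zero
  have hXs : Function.Surjective X := hXc.surjective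
    (by simpa only [X, div_eq_mul_inv] using hvt.pos_mul_atTop h₃ hzt')
    (by simpa only [X, div_eq_mul_inv] using hvb.neg_mul_atTop h₁ hzb')
  let e := hXm.orderIsoOfSurjective X hXs
  have heX : ∀ x, X (e.symm x) = x := fun x => e.apply_symm_apply x
  have hmul : ∀ x, x * z (e.symm x) = v (e.symm x) := by
    intro x
    nth_rw 1 [← heX x]
    exact div_mul_cancel₀ _ (hp _).ne'
  have hT : ∀ x, HasDerivAt e.symm (z (e.symm x))⁻¹ x := fun x =>
    HasDerivAt.of_local_left_inverse e.symm.continuous.continuousAt (hX _) (hp _).ne'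
      (Eventually.of_forall heX)
  refine ⟨fun x => z (e.symm x), fun x => ⟨hp _, ?_⟩, ?_, ?_⟩
  · refine ((hz (e.symm x)).comp x (hT x)).congr_deriv ?_
    rw [hmul]
    have := (hp (e.symm x)).ne'
    field_simp
  · simp only [hmul]
    exact hvt.comp e.symm.tendsto_atTop
  · simp only [hmul]
    exact hvb.comp e.symm.tendsto_atBot

/-- Along a solution of `v' = v f(v) + z²`, `z' = z f(v)` in `z > 0` with `v → L` and `f ≥ 0` on
`[L, ∞)`, the component `v` is strictly increasing where `v ≥ 0`. -/
theorem deriv_pos_of_tendsto {f f' v z : ℝ → ℝ} {L : ℝ} (hf : ∀ u, HasDerivAt f (f' u) u)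
    (hf' : Continuous f')
    (hv : ∀ τ, HasDerivAt v (v τ * f (v τ) + z τ ^ 2) τ)
    (hz : ∀ τ, HasDerivAt z (z τ * f (v τ)) τ) (hp : ∀ τ, 0 < z τ)
    (hL : Tendsto v atTop (𝓝 L)) (hfL : ∀ u, L ≤ u → 0 ≤ f u) (τ₀ : ℝ) (h₀ : 0 ≤ v τ₀) :
    0 < v τ₀ * f (v τ₀) + z τ₀ ^ 2 := by
  by_contra! hD
  have hvc : Continuous v := continuous_iff_continuousAt.2 fun τ => (hv τ).continuousAt
  have hzc : Continuous z := continuous_iff_continuousAt.2 fun τ => (hz τ).continuousAt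
  have hfc : Continuous f := continuous_iff_continuousAt.2 fun τ => (hf τ).continuousAt
  have hv₀ : 0 < v τ₀ := by
    refine lt_of_le_of_ne h₀ fun h => ?_
    rw [← h] at hD
    nlinarith [hp τ₀]
  have hX : Monotone fun τ => v τ / z τ := by
    refine monotone_of_hasDerivAt_nonneg (f' := z) (fun τ => ?_) fun τ => (hp τ).le
    refine ((hv τ).div (hz τ) (hp τ).ne').congr_deriv ?_
    have := (hp τ).ne'
    field_simp
    ring
  have hvpos : ∀ τ, τ₀ ≤ τ → 0 < v τ := by
    intro τ hτ
    have h1 : 0 < v τ / z τ := (div_pos hv₀ (hp τ₀)).trans_le (hX hτ)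
    exact (div_pos_iff_of_pos_right (hp τ)).1 h1
  have hDle : ∀ τ, τ₀ ≤ τ → 0 ≤ -(v τ * f (v τ) + z τ ^ 2) := by
    intro b hb
    refine nonneg_of_mul_le_deriv (f := fun τ => -(v τ * f (v τ) + z τ ^ 2))
      (f' := fun τ => -((f (v τ) + v τ * f' (v τ)) * (v τ * f (v τ) + z τ ^ 2)
        + 2 * z τ ^ 2 * f (v τ)))
      (k := fun τ => f (v τ) + v τ * f' (v τ) + 2 * z τ ^ 2 / v τ) (a := τ₀) (b := b)
      (by fun_prop) ?_ ?_ (neg_nonneg.2 hD) ?_ b ⟨hb, le_rfl⟩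
    · intro τ _
      have h1 := (hf (v τ)).comp τ (hv τ)
      have h2 := (((hv τ).mul h1).add ((hz τ).pow 2)).neg
      refine h2.congr_deriv ?_
      simp only [Function.comp]
      push_cast
      ring
    · refine ContinuousOn.add (by fun_prop) (ContinuousOn.div (by fun_prop) (by fun_prop) ?_)
      intro τ hτ
      exact (hvpos τ hτ.1).ne'
    · intro τ hτ _
      have h1 := hvpos τ hτ.1.le
      have h2 : 0 < 2 * z τ ^ 4 / v τ := by have := hp τ; positivity
      have h3 : -((f (v τ) + v τ * f' (v τ)) * (v τ * f (v τ) + z τ ^ 2)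
        + 2 * z τ ^ 2 * f (v τ)) = (f (v τ) + v τ * f' (v τ) + 2 * z τ ^ 2 / v τ) *
          -(v τ * f (v τ) + z τ ^ 2) + 2 * z τ ^ 4 / v τ := by
        field_simp
        ring
      linarith
  have hanti : AntitoneOn v (Set.Ici τ₀) := by
    refine antitoneOn_of_deriv_nonpos (convex_Ici _) hvc.continuousOn
      (fun τ _ => (hv τ).differentiableAt.differentiableWithinAt) fun τ hτ => ?_
    rw [interior_Ici] at hτ
    rw [(hv τ).deriv]
    linarith [hDle τ (le_of_lt hτ)]
  have hLle : L ≤ v τ₀ := by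
    refine le_of_tendsto hL ?_
    filter_upwards [eventually_ge_atTop τ₀] with τ hτ
    exact hanti Set.self_mem_Ici hτ hτ
  have h1 := hfL _ hLle
  have h2 := mul_nonneg h₀ h1
  have h3 := hp τ₀
  nlinarith

/-- Two distinct roots of `u³ + au² - 1` determine its factorization. -/
theorem cubic_factor {a v₁ v₃ : ℝ} (hne : v₁ ≠ v₃) (h₁ : v₁ ^ 3 + a * v₁ ^ 2 - 1 = 0)
    (h₃ : v₃ ^ 3 + a * v₃ ^ 2 - 1 = 0) (u : ℝ) :
    u ^ 3 + a * u ^ 2 - 1 = (u - v₁) * (u - v₃) * (u + a + v₁ + v₃) := by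
  have hq : v₁ ^ 2 + v₁ * v₃ + v₃ ^ 2 + a * (v₁ + v₃) = 0 := by
    refine mul_left_cancel₀ (sub_ne_zero.2 hne) ?_
    linear_combination h₁ - h₃
  linear_combination h₁ + (u - v₁) * hq

/-- Along a connection of `v' = v f(v) + z²`, `z' = z f(v)`, where `f(v) = v³ + av² - 1`, from
`(v₁,0)` to `(v₃,0)` the component `v` is strictly increasing. -/
theorem connection_deriv_pos {a v₁ v₃ : ℝ} {v z : ℝ → ℝ}
    (hv : ∀ τ, HasDerivAt v (v τ * (v τ ^ 3 + a * v τ ^ 2 - 1) + z τ ^ 2) τ)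
    (hz : ∀ τ, HasDerivAt z (z τ * (v τ ^ 3 + a * v τ ^ 2 - 1)) τ) (hp : ∀ τ, 0 < z τ)
    (hvb : Tendsto v atBot (𝓝 v₁)) (hvt : Tendsto v atTop (𝓝 v₃))
    (hf₁ : ∀ u, u ≤ v₁ → u ^ 3 + a * u ^ 2 - 1 ≤ 0)
    (hf₃ : ∀ u, v₃ ≤ u → 0 ≤ u ^ 3 + a * u ^ 2 - 1) (τ : ℝ) :
    0 < v τ * (v τ ^ 3 + a * v τ ^ 2 - 1) + z τ ^ 2 := by
  rcases le_total 0 (v τ) with h | h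
  · refine deriv_pos_of_tendsto (f := fun u => u ^ 3 + a * u ^ 2 - 1)
      (f' := fun u => 3 * u ^ 2 + a * (2 * u)) (fun u => ?_) (by fun_prop) hv hz hp hvt hf₃ τ h
    simpa using ((hasDerivAt_pow 3 u).add ((hasDerivAt_pow 2 u).const_mul a)).sub_const 1
  · have key := deriv_pos_of_tendsto (f := fun u => u ^ 3 - a * u ^ 2 + 1)
      (f' := fun u => 3 * u ^ 2 - a * (2 * u)) (v := fun τ => -v (-τ)) (z := fun τ => z (-τ))
      (L := -v₁) (fun u => ?_) (by fun_prop) (fun t => ?_) (fun t => ?_) (fun t => hp _)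
      (hvb.comp tendsto_neg_atTop_atBot).neg (fun u hu => ?_) (-τ) (by simpa using h)
    · simp only [neg_neg] at key
      nlinarith [key]
    · simpa using ((hasDerivAt_pow 3 u).sub ((hasDerivAt_pow 2 u).const_mul a)).add_const 1
    · refine (((hv (-t)).comp t (hasDerivAt_neg t)).neg).congr_deriv ?_
      ring
    · refine ((hz (-t)).comp t (hasDerivAt_neg t)).congr_deriv ?_
      ring
    · have := hf₁ (-u) (by linarith)
      nlinarith

/-- A connection can only exist if the cubic is negative at its inflection point. -/
theorem connection_inflection {a v₁ v₃ : ℝ} {v z : ℝ → ℝ} (ha : 0 < a)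
    (hv : ∀ τ, HasDerivAt v (v τ * (v τ ^ 3 + a * v τ ^ 2 - 1) + z τ ^ 2) τ)
    (hz : ∀ τ, HasDerivAt z (z τ * (v τ ^ 3 + a * v τ ^ 2 - 1)) τ) (hp : ∀ τ, 0 < z τ)
    (hvb : Tendsto v atBot (𝓝 v₁)) (hvt : Tendsto v atTop (𝓝 v₃))
    (hzt : Tendsto z atTop (𝓝 0))
    (h₁ : v₁ ^ 3 + a * v₁ ^ 2 - 1 = 0) (h₃ : v₃ ^ 3 + a * v₃ ^ 2 - 1 = 0)
    (hf₁ : ∀ u, u ≤ v₁ → u ^ 3 + a * u ^ 2 - 1 ≤ 0)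
    (hf₃ : ∀ u, v₃ ≤ u → 0 ≤ u ^ 3 + a * u ^ 2 - 1)
    (hv₁ : v₁ < -(a / 3)) (hv₃ : 0 < v₃) : 2 * a ^ 3 < 27 := by
  by_contra! he
  have hD := connection_deriv_pos hv hz hp hvb hvt hf₁ hf₃
  have hfac := cubic_factor (by linarith : v₁ ≠ v₃) h₁ h₃
  set c := a / 3 with hc
  have hc0 : 0 < c := by positivity
  have hac : a = 3 * c := by rw [hc]; ring
  have hec : 1 ≤ 2 * c ^ 3 := by rw [hac] at he; nlinarith
  have hv₂ : v₁ + v₃ ≤ -2 * c := by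
    by_contra! hcon
    have h1 := hfac (-c)
    have h2 : 0 < (-c - v₁) * (c + v₃) * (-c + a + v₁ + v₃) :=
      mul_pos (mul_pos (by linarith) (by linarith)) (by linarith)
    rw [hac] at h1 h2
    nlinarith
  have hvm : StrictMono v := strictMono_of_deriv_pos fun τ => by rw [(hv τ).deriv]; exact hD τ
  have hvc : Continuous v := continuous_iff_continuousAt.2 fun τ => (hv τ).continuousAt
  have hzc : Continuous z := continuous_iff_continuousAt.2 fun τ => (hz τ).continuousAt
  have hlt₃ : ∀ τ, v τ < v₃ := fun τ =>
    (hvm (lt_add_one τ)).trans_le (hvm.monotone.ge_of_tendsto hvt _)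
  obtain ⟨τc, hτc⟩ : ∃ τ, v τ = -c := by
    obtain ⟨t₀, ht₀⟩ := (hvb.eventually_lt_const hv₁).exists
    obtain ⟨t₁, ht₁⟩ := (hvt.eventually_const_lt (show -c < v₃ by linarith)).exists
    exact mem_range_of_exists_le_of_exists_ge hvc ⟨t₀, ht₀.le⟩ ⟨t₁, ht₁.le⟩
  have hlower : ∀ τ₁, -c < v τ₁ →
      z τc ^ 2 * Real.exp (-(v₃ + c) / c) ≤ z τ₁ ^ 2 := by
    intro τ₁ hτ₁
    set b := v τ₁ + c with hb
    have hb0 : 0 < b := by linarith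
    have hb₃ : b < v₃ + c := by linarith [hlt₃ τ₁]
    obtain ⟨τ₀, hτ₀⟩ := (hvb.eventually_lt_const (show v₁ < -c - b by linarith)).exists
    have h01 : τ₀ ≤ τ₁ := (hvm.lt_iff_lt.1 (by linarith : v τ₀ < v τ₁)).le
    obtain ⟨T, hTc, hT, hTd⟩ := exists_inverse_hasDerivAt h01 hvc.continuousOn
      (fun t _ => hv t) fun t _ => hD t
    have hvT : ∀ u ∈ Set.Icc (-c - b) (-c + b), v (T u) = u := fun u hu =>
      (hT u ⟨hτ₀.le.trans hu.1, by linarith [hu.2]⟩).2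
    let W : ℝ → ℝ := fun u => z (T u) ^ 2
    have hWc : Continuous W := by fun_prop
    have hWpos : ∀ u, 0 < W u := fun u => pow_pos (hp _) 2
    have hWD : ∀ u ∈ Set.Icc (-c - b) (-c + b), 0 < u * (u ^ 3 + a * u ^ 2 - 1) + W u := by
      intro u hu
      have := hD (T u)
      rwa [hvT u hu] at this
    have hWd : ∀ u ∈ Set.Ioo (-c - b) (-c + b), HasDerivAt W
        (2 * W u * (u ^ 3 + a * u ^ 2 - 1) / (u * (u ^ 3 + a * u ^ 2 - 1) + W u)) u := by
      intro u hu
      have h1 := (hTd u ⟨hτ₀.trans hu.1, by linarith [hu.2]⟩).2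
      have h2 := ((hz (T u)).comp u h1).pow 2
      rw [hvT u (Set.Ioo_subset_Icc_self hu)] at h2
      refine h2.congr_deriv ?_
      simp only [Function.comp, W]
      push_cast
      ring
    let r : ℝ → ℝ := fun s => (-c + s) ^ 3 + a * (-c + s) ^ 2 - 1
    let g : ℝ → ℝ := fun s => -((-c - s) ^ 3 + a * (-c - s) ^ 2 - 1)
    let R : ℝ → ℝ := fun s => W (-c + s)
    let L : ℝ → ℝ := fun s => W (-c - s)
    have hRc : Continuous R := by fun_prop
    have hLc : Continuous L := by fun_prop
    have hrc : Continuous r := by fun_prop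
    have hgc : Continuous g := by fun_prop
    have hRD : ∀ s ∈ Set.Icc 0 b, 0 < (s - c) * r s + R s := by
      intro s hs
      have := hWD (-c + s) ⟨by linarith [hs.1], by linarith [hs.2]⟩
      simp only [r, R]; linarith
    have hLD : ∀ s ∈ Set.Icc 0 b, 0 < (s + c) * g s + L s := by
      intro s hs
      have := hWD (-c - s) ⟨by linarith [hs.2], by linarith [hs.1]⟩
      simp only [g, L]; linarith
    have hRd : ∀ s ∈ Set.Ioo 0 b,
        HasDerivAt R (2 * R s * r s / ((s - c) * r s + R s)) s := by
      intro s hs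
      have h1 := (hWd (-c + s) ⟨by linarith [hs.1], by linarith [hs.2]⟩).comp s
        ((hasDerivAt_id s).const_add (-c))
      refine h1.congr_deriv ?_
      simp only [r, R]
      rw [mul_one]
      congr 1
      ring
    have hLd : ∀ s ∈ Set.Ioo 0 b,
        HasDerivAt L (2 * L s * g s / ((s + c) * g s + L s)) s := by
      intro s hs
      have h1 := (hWd (-c - s) ⟨by linarith [hs.2], by linarith [hs.1]⟩).comp s
        ((hasDerivAt_id s).const_sub (-c))
      refine h1.congr_deriv ?_
      simp only [g, L]
      rw [mul_neg_one, ← neg_div]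
      congr 1 <;> ring
    have hrg : ∀ s, g s ≤ r s := by
      intro s
      have : r s - g s = 2 * (2 * c ^ 3 - 1) := by
        simp only [r, g, hac]; ring
      linarith
    have hg0 : ∀ s ∈ Set.Icc 0 b, g s ≤ 0 := by
      intro s hs
      have h1 : 0 ≤ (-c - s - v₁) * (v₃ + c + s) * (-(-c - s + a + v₁ + v₃)) :=
        mul_nonneg (mul_nonneg (by linarith [hs.2]) (by linarith [hs.1])) (by linarith [hs.1])
      have h2 := hfac (-c - s)
      simp only [g]
      linarith
    have hRL : ∀ s ∈ Set.Icc 0 b, 0 ≤ R s - L s := by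
      refine nonneg_of_mul_le_deriv (f := fun s => R s - L s)
        (f' := fun s => 2 * R s * r s / ((s - c) * r s + R s)
          - 2 * L s * g s / ((s + c) * g s + L s))
        (k := fun s => 2 * max (r s * g s) 0 * s /
          (((s - c) * r s + R s) * ((s + c) * g s + L s)))
        (by fun_prop) (fun s hs => (hRd s hs).sub (hLd s hs)) ?_ (by simp [R, L]) ?_
      · refine ContinuousOn.div (by fun_prop) (by fun_prop) fun s hs => ?_
        exact (mul_pos (hRD s hs) (hLD s hs)).ne'
      · intro s hs hneg
        have hsI := Set.Ioo_subset_Icc_self hs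
        have hr := hRD s hsI
        have hl := hLD s hsI
        have hg := hg0 s hsI
        have hR0 : 0 < R s := hWpos _
        have hL0 : 0 < L s := hWpos _
        rcases le_or_gt (r s) 0 with h | h
        · rw [max_eq_left (mul_nonneg_of_nonpos_of_nonpos h hg)]
          have h1 : 0 ≤ R s * L s * (r s - g s) + r s * g s * (c * (R s + L s)) :=
            add_nonneg (mul_nonneg (by positivity) (by linarith [hrg s]))
              (mul_nonneg (mul_nonneg_of_nonpos_of_nonpos h hg) (by positivity))
          have hgen : ∀ P Q : ℝ, P ≠ 0 → Q ≠ 0 → P = (s - c) * r s + R s →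
              Q = (s + c) * g s + L s →
              2 * R s * r s / P - 2 * L s * g s / Q
                - 2 * (r s * g s) * s / (P * Q) * (R s - L s)
              = 2 * (R s * L s * (r s - g s) + r s * g s * (c * (R s + L s))) / (P * Q) := by
            intro P Q hP hQ eP eQ
            field_simp
            rw [eP, eQ]
            ring
          have h2 : 2 * R s * r s / ((s - c) * r s + R s)
              - 2 * L s * g s / ((s + c) * g s + L s)
              - 2 * (r s * g s) * s / (((s - c) * r s + R s) * ((s + c) * g s + L s))
                * (R s - L s)
              = 2 * (R s * L s * (r s - g s) + r s * g s * (c * (R s + L s))) /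
                (((s - c) * r s + R s) * ((s + c) * g s + L s)) :=
            hgen _ _ hr.ne' hl.ne' rfl rfl
          have h3 : 0 ≤ 2 * (R s * L s * (r s - g s) + r s * g s * (c * (R s + L s))) /
                (((s - c) * r s + R s) * ((s + c) * g s + L s)) := by positivity
          linarith
        · rw [max_eq_right (mul_nonpos_of_nonneg_of_nonpos h.le hg)]
          have h1 : 0 ≤ 2 * R s * r s / ((s - c) * r s + R s) := by positivity
          have h2 : 2 * L s * g s / ((s + c) * g s + L s) ≤ 0 :=
            div_nonpos_of_nonpos_of_nonneg
              (mul_nonpos_of_nonneg_of_nonpos (by positivity) hg) hl.le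
          simp only [mul_zero, zero_mul, zero_div]
          linarith
    have hexp : ∀ s ∈ Set.Icc 0 b, 0 ≤ R s - R 0 * Real.exp (-(s / c)) := by
      refine nonneg_of_mul_le_deriv (f := fun s => R s - R 0 * Real.exp (-(s / c)))
        (f' := fun s => 2 * R s * r s / ((s - c) * r s + R s)
          - R 0 * (Real.exp (-(s / c)) * (-(1 / c))))
        (k := fun _ => -(1 / c)) (by fun_prop) (fun s hs => ?_) (by fun_prop) (by simp) ?_
      · exact (hRd s hs).sub ((((hasDerivAt_id s).div_const c).neg.exp).const_mul _)
      · intro s hs _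
        have hsI := Set.Ioo_subset_Icc_self hs
        have hr := hRD s hsI
        have hl := hLD s hsI
        have hR0 : 0 < R s := hWpos _
        have h1 : -(1 / c) * R s ≤ 2 * R s * r s / ((s - c) * r s + R s) := by
          rcases le_or_gt (r s) 0 with h | h
          · rw [le_div_iff₀ hr]
            have h2 := hRL s hsI
            have h3 := hrg s
            have h4 : -(2 * c * r s) ≤ (s - c) * r s + R s := by
              nlinarith [mul_nonneg (by linarith [hs.1] : 0 ≤ s + c) (sub_nonneg.2 h3)]
            have h5 : -(1 / c) * R s * ((s - c) * r s + R s)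
                ≤ -(1 / c) * R s * -(2 * c * r s) :=
              mul_le_mul_of_nonpos_left h4 (by
                have : 0 < 1 / c * R s := by positivity
                linarith)
            refine h5.trans (le_of_eq ?_)
            field_simp
          · refine le_trans ?_ (by positivity : 0 ≤ 2 * R s * r s / ((s - c) * r s + R s))
            have : 0 < 1 / c * R s := by positivity
            linarith
        nlinarith [h1]
    have hend := hexp b ⟨hb0.le, le_rfl⟩
    have hTb : T (-c + b) = τ₁ := hvm.injective (by
      rw [hvT _ ⟨by linarith, le_rfl⟩, hb]; ring)
    have hT0 : T (-c + 0) = τc := hvm.injective (by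
      rw [hvT _ ⟨by linarith, by linarith⟩, hτc]; ring)
    simp only [R, W, hTb, hT0] at hend
    have h6 : Real.exp (-(v₃ + c) / c) ≤ Real.exp (-(b / c)) := by
      rw [Real.exp_le_exp, neg_div, neg_le_neg_iff]
      gcongr
    have h7 := mul_le_mul_of_nonneg_left h6 (sq_nonneg (z τc))
    linarith
  have hpos : 0 < z τc ^ 2 * Real.exp (-(v₃ + c) / c) := mul_pos (pow_pos (hp _) 2) (Real.exp_pos _)
  have hlim : Tendsto (fun τ => z τ ^ 2) atTop (𝓝 0) := by simpa using hzt.pow 2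
  obtain ⟨τ, h1, h2⟩ := ((hlim.eventually_lt_const hpos).and
    (hvt.eventually_const_lt (show -c < v₃ by linarith))).exists
  exact absurd (hlower τ h2) (not_le.2 h1)

/-- An arc of the equation with larger parameter that blows up at its left end lies above any global
graph. -/
theorem le_of_tendsto_atTop_left {a a' X₁ X₂ : ℝ} {Γ Z : ℝ → ℝ} (haa : a ≤ a')
    (hΓd : ∀ x, HasDerivAt Γ ((x * Γ x) ^ 3 + a * (x * Γ x) ^ 2 - 1) x)
    (hZd : ∀ x ∈ Set.Ioo (-X₁) X₂, HasDerivAt Z ((x * Z x) ^ 3 + a' * (x * Z x) ^ 2 - 1) x)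
    (hZt : Tendsto Z (𝓝[>] (-X₁)) atTop) : ∀ x ∈ Set.Ioo (-X₁) X₂, Γ x ≤ Z x := by
  intro x hx
  have hΓc : Continuous Γ := continuous_iff_continuousAt.2 fun x => (hΓd x).continuousAt
  obtain ⟨c, ⟨h1, h2⟩, h3⟩ := (((hZt.eventually_ge_atTop (Γ (-X₁) + 1)).and
    (hΓc.continuousWithinAt.eventually_lt_const (lt_add_one _))).and
      (Ioo_mem_nhdsGT hx.1)).exists
  have hsub : ∀ t ∈ Set.Icc c x, t ∈ Set.Ioo (-X₁) X₂ := fun t ht =>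
    ⟨h3.1.trans_le ht.1, ht.2.trans_lt hx.2⟩
  have hZc : ContinuousOn Z (Set.Icc c x) := fun t ht =>
    (hZd t (hsub t ht)).continuousAt.continuousWithinAt
  refine sub_nonneg.1 (nonneg_of_mul_le_deriv (f := fun t => Z t - Γ t) (b := x)
    (f' := fun t => ((t * Z t) ^ 3 + a' * (t * Z t) ^ 2 - 1)
      - ((t * Γ t) ^ 3 + a * (t * Γ t) ^ 2 - 1))
    (k := fun t => t ^ 3 * (Z t ^ 2 + Z t * Γ t + Γ t ^ 2) + a * t ^ 2 * (Z t + Γ t))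
    (hZc.sub hΓc.continuousOn)
    (fun t ht => (hZd t (hsub t (Set.Ioo_subset_Icc_self ht))).sub (hΓd t))
    (by fun_prop) (by linarith) (fun t _ _ => ?_) x ⟨h3.2.le, le_rfl⟩)
  have : 0 ≤ (a' - a) * (t * Z t) ^ 2 := mul_nonneg (by linarith) (sq_nonneg _)
  linarith

/-- The graph of a connection satisfies `Γ(x) - Γ(-x) > -2a / (3x)` for `x > 0`. -/
theorem connection_asymmetry {a v₁ v₃ : ℝ} {Γ : ℝ → ℝ} (ha : 0 < a) (he : 2 * a ^ 3 < 27)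
    (hΓd : ∀ x, HasDerivAt Γ ((x * Γ x) ^ 3 + a * (x * Γ x) ^ 2 - 1) x)
    (ht : Tendsto (fun x => x * Γ x) atTop (𝓝 v₃))
    (hb : Tendsto (fun x => x * Γ x) atBot (𝓝 v₁)) (hs : 0 < v₁ + v₃ + 2 * a / 3) :
    ∀ x, 0 < x → 0 < x * (Γ x - Γ (-x)) + 2 * a / 3 := by
  intro x₀ hx₀
  by_contra! hneg
  have hΓc : Continuous Γ := continuous_iff_continuousAt.2 fun x => (hΓd x).continuousAt
  have hΔ : ∀ x, x₀ ≤ x → 0 ≤ -(x * (Γ x - Γ (-x)) + 2 * a / 3) := by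
    intro b hb
    refine nonneg_of_mul_le_deriv (f := fun x => -(x * (Γ x - Γ (-x)) + 2 * a / 3)) (a := x₀)
      (f' := fun x => -((Γ x - Γ (-x)) + x * (((x * Γ x) ^ 3 + a * (x * Γ x) ^ 2 - 1)
        + ((-x * Γ (-x)) ^ 3 + a * (-x * Γ (-x)) ^ 2 - 1))))
      (k := fun x => 1 / x + x * (3 / 4 * x ^ 2 * (Γ x + Γ (-x)) ^ 2
        + 1 / 4 * (x * (Γ x - Γ (-x)) + 2 * a / 3) ^ 2 - a ^ 2 / 3)) (b := b)
      (by fun_prop) (fun x hx => ?_) ?_ (by linarith) (fun x hx _ => ?_) b ⟨hb, le_rfl⟩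
    · have h1 := (hΓd (-x)).comp x (hasDerivAt_neg x)
      refine ((((hasDerivAt_id x).mul ((hΓd x).sub h1)).add_const (2 * a / 3)).neg).congr_deriv ?_
      simp only [Function.comp, Pi.sub_apply, id]
      ring
    · refine ContinuousOn.add (ContinuousOn.div (by fun_prop) (by fun_prop) fun x hx => ?_)
        (by fun_prop)
      exact (hx₀.trans_le hx.1).ne'
    · have hx0 : 0 < x := hx₀.trans hx.1
      have h1 : 0 ≤ 2 * a / 3 / x + 2 * x * (1 - 2 * a ^ 3 / 27) :=
        add_nonneg (by positivity) (mul_nonneg (by positivity) (by linarith))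
      refine sub_nonneg.1 (h1.trans_eq ?_)
      field_simp
      ring
  have hlim : Tendsto (fun x => -(x * (Γ x - Γ (-x)) + 2 * a / 3)) atTop
      (𝓝 (-(v₃ + v₁ + 2 * a / 3))) := by
    refine (((ht.add (hb.comp tendsto_neg_atTop_atBot)).add_const (2 * a / 3)).neg).congr fun x => ?_
    simp only [Function.comp]
    ring
  have := ge_of_tendsto hlim ((eventually_ge_atTop x₀).mono hΔ)
  linarith

/-- A positive arc of `z' = (xz)³ + a'(xz)² - 1` lying above the graph of a connection for
`a ≤ a'` is at least as asymmetric as the connection. -/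
theorem asymmetry_le {a a' X : ℝ} {Γ Z : ℝ → ℝ} (haa : a ≤ a')
    (hΓ : ∀ x, 0 < Γ x) (hΓd : ∀ x, HasDerivAt Γ ((x * Γ x) ^ 3 + a * (x * Γ x) ^ 2 - 1) x)
    (hΔ : ∀ x, 0 < x → 0 < x * (Γ x - Γ (-x)) + 2 * a / 3)
    (hZd : ∀ x ∈ Set.Ioo (-X) X, HasDerivAt Z ((x * Z x) ^ 3 + a' * (x * Z x) ^ 2 - 1) x)
    (hle : ∀ x ∈ Set.Ioo (-X) X, Γ x ≤ Z x) :
    ∀ x ∈ Set.Ico 0 X, Γ x - Γ (-x) ≤ Z x - Z (-x) := by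
  intro b hb
  have hΓc : Continuous Γ := continuous_iff_continuousAt.2 fun x => (hΓd x).continuousAt
  have hsub : ∀ t ∈ Set.Icc 0 b, t ∈ Set.Ioo (-X) X := fun t ht =>
    ⟨by linarith [ht.1, ht.2, hb.2], ht.2.trans_lt hb.2⟩
  have hsub' : ∀ t ∈ Set.Icc 0 b, -t ∈ Set.Ioo (-X) X := fun t ht =>
    ⟨by linarith [ht.1, ht.2, hb.2], by linarith [ht.1, ht.2, hb.2]⟩
  have hA : ContinuousOn Z (Set.Icc 0 b) := fun t ht =>
    (hZd t (hsub t ht)).continuousAt.continuousWithinAt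
  obtain ⟨B, hBdef⟩ : ∃ B : ℝ → ℝ, B = fun t => Z (-t) := ⟨_, rfl⟩
  have hBd : ∀ t ∈ Set.Icc 0 b,
      HasDerivAt B (-((-t * B t) ^ 3 + a' * (-t * B t) ^ 2 - 1)) t := by
    intro t ht
    rw [hBdef]
    exact ((hZd (-t) (hsub' t ht)).comp t (hasDerivAt_neg t)).congr_deriv (by ring)
  have hB : ContinuousOn B (Set.Icc 0 b) := fun t ht =>
    (hBd t ht).continuousAt.continuousWithinAt
  rw [show Z (-b) = B b by rw [hBdef]]
  refine sub_nonneg.1 (nonneg_of_mul_le_deriv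
    (f := fun x => (Z x - B x) - (Γ x - Γ (-x))) (a := 0) (b := b)
    (f' := fun x => (((x * Z x) ^ 3 + a' * (x * Z x) ^ 2 - 1)
        + ((-x * B x) ^ 3 + a' * (-x * B x) ^ 2 - 1))
      - (((x * Γ x) ^ 3 + a * (x * Γ x) ^ 2 - 1)
        + ((-x * Γ (-x)) ^ 3 + a * (-x * Γ (-x)) ^ 2 - 1)))
    (k := fun x => x * (3 / 4 * x ^ 2 * (Z x + B x) ^ 2
      + 1 / 4 * ((x * (Z x - B x) + 2 * a / 3) ^ 2
        + (x * (Z x - B x) + 2 * a / 3) * (x * (Γ x - Γ (-x)) + 2 * a / 3)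
        + (x * (Γ x - Γ (-x)) + 2 * a / 3) ^ 2) - a ^ 2 / 3))
    (by fun_prop) (fun x hx => ?_) (by fun_prop) (by simp [hBdef]) (fun x hx _ => ?_) b ⟨hb.1, le_rfl⟩)
  · have hx := Set.Ioo_subset_Icc_self hx
    have h1 := (hΓd (-x)).comp x (hasDerivAt_neg x)
    have h2 := hBd x hx
    refine (((hZd x (hsub x hx)).sub h2).sub ((hΓd x).sub h1)).congr_deriv ?_
    ring
  · have h0 := Set.Ioo_subset_Icc_self hx
    have h1 : 0 ≤ (a' - a) * (x ^ 2 * (Z x ^ 2 + B x ^ 2)) :=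
      mul_nonneg (by linarith) (by positivity)
    have h2 := hle x (hsub x h0)
    have h3 : Γ (-x) ≤ B x := by rw [hBdef]; exact hle (-x) (hsub' x h0)
    have h4 := hΓ x
    have h5 := hΓ (-x)
    have h6 : 0 ≤ 3 / 4 * x ^ 2 * (x * (Γ x - Γ (-x)) + 2 * a / 3) *
        ((Z x - Γ x + (B x - Γ (-x))) * (Z x + B x + Γ x + Γ (-x))) :=
      mul_nonneg (mul_nonneg (by positivity) (hΔ x hx.1).le)
        (mul_nonneg (by linarith) (by linarith))
    refine sub_nonneg.1 ((add_nonneg h1 h6).trans_eq ?_)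
    ring

/-- The asymmetry grows at least like the logarithm of the larger side. -/
theorem asymmetry_log_estimate {a a' m x X A B : ℝ} (ha : 0 < a) (haa : a ≤ a') (hm : 0 < m)
    (hX : 0 < X) (hxX : x ≤ X) (hxp : 0 < x) (hA : 0 < A) (hB : 1 ≤ B)
    (hΔ : m ≤ x * (A - B) + 2 * a / 3) (hle : A ≤ B) :
    3 / 4 * m * (((x * B) ^ 3 - a' * (x * B) ^ 2 + 1) / B)
      ≤ X * (((x * A) ^ 3 + a' * (x * A) ^ 2 - 1) - ((x * B) ^ 3 - a' * (x * B) ^ 2 + 1))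
        + (X * (2 * a ^ 3 / 9 + 2) + 3 / 4 * m) := by
  have ha' : 0 < a' := ha.trans_le haa
  obtain ⟨Δ, hΔdef⟩ : ∃ Δ, Δ = x * (A - B) + 2 * a / 3 := ⟨_, rfl⟩
  rw [← hΔdef] at hΔ
  have hΔ₂ : Δ ≤ 2 * a / 3 := by
    have : x * (A - B) ≤ 0 := mul_nonpos_of_nonneg_of_nonpos hxp.le (by linarith)
    linarith
  have hΔ₀ : 0 < Δ := by linarith
  have h1 : ((x * A) ^ 3 + a' * (x * A) ^ 2 - 1) - ((x * B) ^ 3 - a' * (x * B) ^ 2 + 1)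
      = (a' - a) * x ^ 2 * (A ^ 2 + B ^ 2) + 3 / 4 * x ^ 2 * Δ * (A + B) ^ 2 + 1 / 4 * Δ ^ 3
        - a ^ 2 / 3 * Δ + 4 * a ^ 3 / 27 - 2 := by
    rw [hΔdef]; ring
  have h2 : 0 ≤ (a' - a) * x ^ 2 * (A ^ 2 + B ^ 2) :=
    mul_nonneg (mul_nonneg (by linarith) (by positivity)) (by positivity)
  have h3 : 3 / 4 * x ^ 2 * m * B ^ 2 ≤ 3 / 4 * x ^ 2 * Δ * (A + B) ^ 2 := by
    gcongr; linarith
  have h4 : a ^ 2 / 3 * Δ ≤ a ^ 2 / 3 * (2 * a / 3) := by gcongr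
  have h5 : 0 < 1 / 4 * Δ ^ 3 := by positivity
  have h6 : 0 < 4 * a ^ 3 / 27 := by positivity
  have h7 : X * (3 / 4 * x ^ 2 * m * B ^ 2 - (2 * a ^ 3 / 9 + 2))
      ≤ X * (((x * A) ^ 3 + a' * (x * A) ^ 2 - 1) - ((x * B) ^ 3 - a' * (x * B) ^ 2 + 1)) := by
    refine mul_le_mul_of_nonneg_left ?_ hX.le
    rw [h1]
    linarith
  have h8 : ((x * B) ^ 3 - a' * (x * B) ^ 2 + 1) / B ≤ X * x ^ 2 * B ^ 2 + 1 := by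
    have hB0 : 0 < B := by linarith
    have h9 : x * (x ^ 2 * B ^ 3) ≤ X * (x ^ 2 * B ^ 3) := by gcongr
    have h10 : 0 < a' * (x * B) ^ 2 := by positivity
    rw [div_le_iff₀ (by linarith)]
    linarith
  have h9 : 3 / 4 * m * (((x * B) ^ 3 - a' * (x * B) ^ 2 + 1) / B)
      ≤ 3 / 4 * m * (X * x ^ 2 * B ^ 2 + 1) := by gcongr
  linarith

/-- If a positive arc of `z' = (xz)³ + a'(xz)² - 1` blows up at the left end `-X`, its asymmetry
cannot stay bounded below by a positive amount. -/
theorem not_blowup_of_asymmetry {a a' X m : ℝ} {Z : ℝ → ℝ} (ha : 0 < a) (haa : a ≤ a')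
    (hX : 0 < X) (hm : 0 < m)
    (hZd : ∀ x ∈ Set.Ioo (-X) X, HasDerivAt Z ((x * Z x) ^ 3 + a' * (x * Z x) ^ 2 - 1) x)
    (hZt : Tendsto Z (𝓝[>] (-X)) atTop)
    (hΔ : ∀ x ∈ Set.Ico (X / 2) X, m ≤ x * (Z x - Z (-x)) + 2 * a / 3) : False := by
  have ha' : 0 < a' := ha.trans_le haa
  have hBt : Tendsto (fun x => Z (-x)) (𝓝[<] X) atTop := by
    refine hZt.comp ?_
    have := tendsto_neg_nhdsLT (a := X)
    exact this
  set N := 1 + 4 / (a' * X ^ 2) with hN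
  have hN1 : 1 ≤ N := by
    have : 0 < 4 / (a' * X ^ 2) := by positivity
    linarith
  have hNX : 1 ≤ a' * (X / 2) ^ 2 * N ^ 2 := by
    have h1 : a' * (X / 2) ^ 2 * N = a' * (X / 2) ^ 2 + 1 := by rw [hN]; field_simp; ring
    have h2 : 0 < a' * (X / 2) ^ 2 := by positivity
    nlinarith
  obtain ⟨x₀, hx₀X : x₀ < X, hx₀⟩ := mem_nhdsLT_iff_exists_Ico_subset.1
    ((hBt.eventually_ge_atTop (4 * a / (3 * X) + N)).and
      (Ioo_mem_nhdsLT (show X / 2 < X by linarith)))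
  have hge : ∀ x ∈ Set.Ico x₀ X, X / 2 < x ∧ x < X ∧ N ≤ Z x ∧ N ≤ Z (-x) := by
    intro x hx
    obtain ⟨h1, h2⟩ := hx₀ hx
    have h3 : 0 < 4 * a / (3 * X) := by positivity
    refine ⟨h2.1, h2.2, ?_, by linarith⟩
    have h4 := hΔ x ⟨h2.1.le, h2.2⟩
    have h5 : 0 < x := by linarith [h2.1]
    by_contra! h6
    have h7 : x * (Z x - Z (-x)) ≤ x * -(4 * a / (3 * X)) := by gcongr; linarith
    have h8 : X / 2 * (4 * a / (3 * X)) ≤ x * (4 * a / (3 * X)) := by gcongr; exact h2.1.le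
    have h9 : X / 2 * (4 * a / (3 * X)) = 2 * a / 3 := by field_simp; ring
    linarith
  have hx₀pos : X / 2 < x₀ := (hge x₀ ⟨le_rfl, hx₀X⟩).1
  have hI : ∀ x ∈ Set.Ico x₀ X, x ∈ Set.Ioo (-X) X ∧ -x ∈ Set.Ioo (-X) X := fun x hx =>
    have := hge x hx
    ⟨⟨by linarith, by linarith⟩, ⟨by linarith, by linarith⟩⟩
  have hAd : ∀ x ∈ Set.Ico x₀ X, HasDerivAt Z ((x * Z x) ^ 3 + a' * (x * Z x) ^ 2 - 1) x :=
    fun x hx => hZd x (hI x hx).1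
  have hBd : ∀ x ∈ Set.Ico x₀ X, HasDerivAt (fun x => Z (-x))
      ((x * Z (-x)) ^ 3 - a' * (x * Z (-x)) ^ 2 + 1) x := fun x hx =>
    ((hZd (-x) (hI x hx).2).comp x (hasDerivAt_neg x)).congr_deriv (by ring)
  have hbig : ∀ x y, X / 2 < x → N ≤ y → 0 ≤ a' * x ^ 2 * y ^ 2 - 1 := by
    intro x y hx hy
    have : a' * (X / 2) ^ 2 * N ^ 2 ≤ a' * x ^ 2 * y ^ 2 := by gcongr
    linarith
  have hAB : ∀ x ∈ Set.Ico x₀ X, Z x ≤ Z (-x) := by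
    intro x₁ hx₁
    by_contra! hlt
    have hanti : AntitoneOn (fun x => (Z x ^ 2)⁻¹ - (Z (-x) ^ 2)⁻¹) (Set.Ico x₀ X) := by
      have hd : ∀ x ∈ Set.Ico x₀ X, HasDerivAt (fun x => (Z x ^ 2)⁻¹ - (Z (-x) ^ 2)⁻¹)
          (-(2 * (a' * x ^ 2 * Z x ^ 2 - 1) / Z x ^ 3)
            - 2 * (a' * x ^ 2 * Z (-x) ^ 2 - 1) / Z (-x) ^ 3) x := by
        intro x hx
        obtain ⟨-, -, h1, h2⟩ := hge x hx
        have h3 : Z x ≠ 0 := by linarith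
        have h4 : Z (-x) ≠ 0 := by linarith
        refine ((((hAd x hx).pow 2).inv (pow_ne_zero 2 h3)).sub
          (((hBd x hx).pow 2).inv (pow_ne_zero 2 h4))).congr_deriv ?_
        simp only [Pi.pow_apply]
        field_simp
        ring
      refine antitoneOn_of_deriv_nonpos (convex_Ico _ _)
        (fun x hx => (hd x hx).continuousAt.continuousWithinAt)
        (fun x hx => (hd x (interior_subset hx)).differentiableAt.differentiableWithinAt)
        fun x hx => ?_
      have hx := interior_subset hx
      rw [(hd x hx).deriv]
      obtain ⟨h0, -, h1, h2⟩ := hge x hx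
      have h5 : 0 ≤ 2 * (a' * x ^ 2 * Z x ^ 2 - 1) / Z x ^ 3 :=
        div_nonneg (by linarith [hbig x _ h0 h1]) (pow_nonneg (by linarith) 3)
      have h6 : 0 ≤ 2 * (a' * x ^ 2 * Z (-x) ^ 2 - 1) / Z (-x) ^ 3 :=
        div_nonneg (by linarith [hbig x _ h0 h2]) (pow_nonneg (by linarith) 3)
      linarith
    obtain ⟨-, -, h1, h2⟩ := hge x₁ hx₁
    have hη : 0 < (Z (-x₁) ^ 2)⁻¹ - (Z x₁ ^ 2)⁻¹ := by
      rw [sub_pos]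
      have : 0 < Z (-x₁) := by linarith
      gcongr
    have hlim : Tendsto (fun x => (Z (-x) ^ 2)⁻¹) (𝓝[<] X) (𝓝 0) :=
      ((tendsto_pow_atTop two_ne_zero).comp hBt).inv_tendsto_atTop
    obtain ⟨x, h3, h4⟩ := ((hlim.eventually_lt_const hη).and (Ioo_mem_nhdsLT hx₁.2)).exists
    have h5 : x ∈ Set.Ico x₀ X := ⟨hx₁.1.trans h4.1.le, h4.2⟩
    have h6 := hanti hx₁ h5 h4.1.le
    have h7 : 0 < (Z x ^ 2)⁻¹ := by
      have : 0 < Z x := by linarith [(hge x h5).2.2.1]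
      positivity
    simp only at h6
    linarith
  set C := X * (2 * a ^ 3 / 9 + 2) + 3 / 4 * m with hC
  let ψ : ℝ → ℝ := fun x => X * (Z x - Z (-x)) - 3 / 4 * m * Real.log (Z (-x)) + C * x
  have hψ : MonotoneOn ψ (Set.Ico x₀ X) := by
    have hd : ∀ x ∈ Set.Ico x₀ X, HasDerivAt ψ
        (X * (((x * Z x) ^ 3 + a' * (x * Z x) ^ 2 - 1)
          - ((x * Z (-x)) ^ 3 - a' * (x * Z (-x)) ^ 2 + 1))
          - 3 / 4 * m * (((x * Z (-x)) ^ 3 - a' * (x * Z (-x)) ^ 2 + 1) / Z (-x)) + C) x := by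
      intro x hx
      obtain ⟨-, -, h1, h2⟩ := hge x hx
      have h4 : Z (-x) ≠ 0 := by linarith
      exact (((((hAd x hx).sub (hBd x hx)).const_mul X).sub
        (((hBd x hx).log h4).const_mul (3 / 4 * m))).add
          ((hasDerivAt_id x).const_mul C)).congr_deriv (by ring)
    refine monotoneOn_of_deriv_nonneg (convex_Ico _ _)
      (fun x hx => (hd x hx).continuousAt.continuousWithinAt)
      (fun x hx => (hd x (interior_subset hx)).differentiableAt.differentiableWithinAt)
      fun x hx => ?_
    have hx := interior_subset hx
    rw [(hd x hx).deriv]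
    obtain ⟨h0, h0', h1, h2⟩ := hge x hx
    have hxp : 0 < x := by linarith
    have hA : 0 < Z x := by linarith
    have hB : 1 ≤ Z (-x) := by linarith
    have hΔ₁ := hΔ x ⟨h0.le, h0'⟩
    have hle := hAB x hx
    have := asymmetry_log_estimate (A := Z x) (B := Z (-x)) ha haa hm hX h0'.le hxp hA hB hΔ₁ hle
    rw [hC]
    linarith
  have hlog : Tendsto (fun x => Real.log (Z (-x))) (𝓝[<] X) atTop := Real.tendsto_log_atTop.comp hBt
  have hCpos : 0 < C := by positivity
  obtain ⟨x, h1, h2⟩ := ((hlog.eventually_gt_atTop ((C * X - ψ x₀) / (3 / 4 * m))).and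
    (Ioo_mem_nhdsLT hx₀X)).exists
  have h3 : x ∈ Set.Ico x₀ X := ⟨h2.1.le, h2.2⟩
  have h4 := hψ ⟨le_rfl, hx₀X⟩ h3 h2.1.le
  have h5 := hAB x h3
  rw [div_lt_iff₀ (by positivity)] at h1
  have h6 : C * x ≤ C * X := by gcongr; exact h2.2.le
  have h7 : X * (Z x - Z (-x)) ≤ 0 := mul_nonpos_of_nonneg_of_nonpos hX.le (by linarith)
  have h8 : ψ x = X * (Z x - Z (-x)) - 3 / 4 * m * Real.log (Z (-x)) + C * x := rfl
  linarith

/-- A connection for the parameter `a` excludes arcs over `(-X₁, X₂)`, `X₁ ≤ X₂`, blowing up at the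
left end, for all parameters `a' ≥ a`. -/
theorem no_arc_of_connection {a a' v₁ v₃ X₁ X₂ : ℝ} {Γ Z : ℝ → ℝ} (ha : 0 < a) (haa : a ≤ a')
    (he : 2 * a ^ 3 < 27)
    (hΓ : ∀ x, 0 < Γ x ∧ HasDerivAt Γ ((x * Γ x) ^ 3 + a * (x * Γ x) ^ 2 - 1) x)
    (ht : Tendsto (fun x => x * Γ x) atTop (𝓝 v₃))
    (hb : Tendsto (fun x => x * Γ x) atBot (𝓝 v₁)) (hs : 0 < v₁ + v₃ + 2 * a / 3)
    (hX : 0 < X₁) (hX₂ : X₁ ≤ X₂)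
    (hZ : ∀ x ∈ Set.Ioo (-X₁) X₂,
      0 < Z x ∧ HasDerivAt Z ((x * Z x) ^ 3 + a' * (x * Z x) ^ 2 - 1) x)
    (hZt : Tendsto Z (𝓝[>] (-X₁)) atTop) : False := by
  have hsub : ∀ x ∈ Set.Ioo (-X₁) X₁, x ∈ Set.Ioo (-X₁) X₂ := fun x hx =>
    ⟨hx.1, hx.2.trans_le hX₂⟩
  have hΓc : Continuous Γ := continuous_iff_continuousAt.2 fun x => (hΓ x).2.continuousAt
  have hΔ := connection_asymmetry ha he (fun x => (hΓ x).2) ht hb hs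
  have hle := asymmetry_le haa (fun x => (hΓ x).1) (fun x => (hΓ x).2) hΔ
    (fun x hx => (hZ x (hsub x hx)).2) (le_of_tendsto_atTop_left haa (fun x => (hΓ x).2)
      (fun x hx => (hZ x (hsub x hx)).2) hZt)
  obtain ⟨c, hc, hmin⟩ := (isCompact_Icc (a := X₁ / 2) (b := X₁)).exists_isMinOn
    ⟨X₁, by linarith, le_rfl⟩
    (f := fun x => x * (Γ x - Γ (-x)) + 2 * a / 3) (by fun_prop)
  refine not_blowup_of_asymmetry ha haa hX (hΔ c (by linarith [hc.1]))
    (fun x hx => (hZ x (hsub x hx)).2) hZt fun x hx => ?_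
  have h0 : 0 < x := by linarith [hx.1]
  refine (hmin (Set.Ico_subset_Icc_self hx)).trans ?_
  have := hle x ⟨h0.le, hx.2⟩
  simp only
  gcongr

/-- The heteroclinic connection as a graph, together with the root and parameter inequalities it
entails. -/
theorem graph_of_heteroclinic {α : ℝ} (hα : α < -3 * (4 : ℝ) ^ (-(1 : ℝ) / 3))
    (h : HasHeteroclinic α) : 0 < -α ∧ 2 * (-α) ^ 3 < 27 ∧ ∃ (Γ : ℝ → ℝ) (v₁ v₃ : ℝ),
      (∀ x, 0 < Γ x ∧ HasDerivAt Γ ((x * Γ x) ^ 3 + -α * (x * Γ x) ^ 2 - 1) x) ∧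
      Tendsto (fun x => x * Γ x) atTop (𝓝 v₃) ∧ Tendsto (fun x => x * Γ x) atBot (𝓝 v₁) ∧
      0 < v₁ + v₃ + 2 * -α / 3 := by
  obtain ⟨v, z, v₁, v₃, ⟨h₁, hmin⟩, ⟨h₃, hmax⟩, hvz, hb, ht⟩ := h
  have hf : ∀ u, fcubic u α = u ^ 3 + -α * u ^ 2 - 1 := fun u => by rw [fcubic]; ring
  simp only [hf] at *
  obtain ⟨a, rfl⟩ : ∃ a, α = -a := ⟨-α, by ring⟩
  simp only [neg_neg] at *
  set w := (4 : ℝ) ^ (-(1 : ℝ) / 3) with hw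
  have hw0 : 0 < w := by positivity
  have hw3 : w ^ 3 = 1 / 4 := by
    rw [hw, ← Real.rpow_natCast, ← Real.rpow_mul (by norm_num)]
    norm_num [Real.rpow_neg_one]
  have ha3 : 27 < 4 * a ^ 3 := by
    have : (3 * w) ^ 3 < a ^ 3 := by gcongr; linarith
    rw [mul_pow, hw3] at this
    linarith
  have ha : 0 < a := by linarith
  have hcont : Continuous fun u : ℝ => u ^ 3 + a * u ^ 2 - 1 := by fun_prop
  have hv₁ : v₁ < -(2 * a / 3) := by
    obtain ⟨u, hu, hu0⟩ := intermediate_value_Ioo (show -a ≤ -(2 * a / 3) by linarith)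
      hcont.continuousOn (show (0 : ℝ) ∈ Set.Ioo _ _ from ⟨by ring_nf; norm_num, by
        ring_nf; linarith⟩)
    exact (hmin u hu0).trans_lt hu.2
  have hv₃ : 0 < v₃ := by
    obtain ⟨u, hu, hu0⟩ := intermediate_value_Ioo (show (0 : ℝ) ≤ 1 by norm_num)
      hcont.continuousOn (show (0 : ℝ) ∈ Set.Ioo _ _ from ⟨by norm_num, by simpa using ha⟩)
    exact hu.1.trans_le (hmax u hu0)
  have hf₃ : ∀ u, v₃ ≤ u → 0 ≤ u ^ 3 + a * u ^ 2 - 1 := by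
    intro u hu
    have : v₃ ^ 3 + a * v₃ ^ 2 ≤ u ^ 3 + a * u ^ 2 := by gcongr
    linarith
  have hf₁ : ∀ u, u ≤ v₁ → u ^ 3 + a * u ^ 2 - 1 ≤ 0 := by
    intro u hu
    have e : u ^ 3 + a * u ^ 2 - 1
        = (u - v₁) * (u ^ 2 + u * v₁ + v₁ ^ 2 + a * (u + v₁)) := by linear_combination h₁
    rw [e]
    refine mul_nonpos_of_nonpos_of_nonneg (by linarith) ?_
    obtain ⟨p, hp⟩ : ∃ p, p = -(2 * a / 3) - u := ⟨_, rfl⟩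
    obtain ⟨q, hq⟩ : ∃ q, q = -(2 * a / 3) - v₁ := ⟨_, rfl⟩
    have hp0 : 0 ≤ p := by linarith
    have hq0 : 0 ≤ q := by linarith
    have : 0 ≤ a * (p + q) + p ^ 2 + p * q + q ^ 2 := by positivity
    refine this.trans_eq ?_
    rw [hp, hq]; ring
  have hvb : Tendsto v atBot (𝓝 v₁) := (continuous_fst.tendsto _).comp hb
  have hvt : Tendsto v atTop (𝓝 v₃) := (continuous_fst.tendsto _).comp ht
  have hzb : Tendsto z atBot (𝓝 0) := (continuous_snd.tendsto _).comp hb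
  have hzt : Tendsto z atTop (𝓝 0) := (continuous_snd.tendsto _).comp ht
  have he := connection_inflection ha (fun τ => (hvz τ).1) (fun τ => (hvz τ).2.1)
    (fun τ => (hvz τ).2.2) hvb hvt hzt h₁ h₃ hf₁ hf₃ (by linarith) hv₃
  obtain ⟨Γ, hΓ, hΓt, hΓb⟩ := exists_graph_of_connection
    (f := fun u => u ^ 3 + a * u ^ 2 - 1) (fun τ => (hvz τ).1) (fun τ => (hvz τ).2.1)
    (fun τ => (hvz τ).2.2) (by linarith) hv₃ hvb hvt hzb hzt
  refine ⟨ha, he, Γ, v₁, v₃, hΓ, hΓt, hΓb, ?_⟩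
  by_contra! hcon
  have h5 := cubic_factor (by linarith : v₁ ≠ v₃) h₁ h₃ (-(a / 3))
  have h6 : 0 ≤ (-(a / 3) - v₁) * (v₃ - -(a / 3)) * -(-(a / 3) + a + v₁ + v₃) :=
    mul_nonneg (mul_nonneg (by linarith) (by linarith)) (by linarith)
  nlinarith

theorem IsPeriodicSol.exists_ge {x y : ℝ → ℝ} (hp : IsPeriodicSol x y) (t₀ t : ℝ) :
    ∃ s, t₀ ≤ s ∧ x s = x t ∧ y s = y t := by
  obtain ⟨T, hT, h⟩ := hp
  have hper : Function.Periodic (fun t => (x t, y t)) T := fun t =>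
    Prod.ext (h t).1 (h t).2
  obtain ⟨s, hs, hst⟩ := hper.exists_mem_Ico hT t t₀
  exact ⟨s, hs.1, (congrArg Prod.fst hst).symm, (congrArg Prod.snd hst).symm⟩

theorem IsSolXY.hasDerivAt_energy {α : ℝ} {x y : ℝ → ℝ} (hs : IsSolXY α x y) (t : ℝ) :
    HasDerivAt (fun t => y t ^ 2 / 2 + x t ^ 4 / 4)
      (y t ^ 2 * (α * x t ^ 2 + y t ^ 2)) t := by
  refine ((((hs t).2.pow 2).div_const 2).add (((hs t).1.pow 4).div_const 4)).congr_deriv ?_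
  push_cast
  ring

/-- A nonconstant periodic solution does not pass through the origin. -/
theorem IsSolXY.ne_zero {α : ℝ} {x y : ℝ → ℝ} (hs : IsSolXY α x y) (hp : IsPeriodicSol x y)
    (hn : NonconstSol x y) (t₀ : ℝ) (hy : y t₀ = 0) : x t₀ ≠ 0 := by
  intro hx
  have hxc : Continuous x := continuous_iff_continuousAt.2 fun t => (hs t).1.continuousAt
  have hyc : Continuous y := continuous_iff_continuousAt.2 fun t => (hs t).2.continuousAt
  have hzero : ∀ t, t₀ ≤ t → x t = 0 ∧ y t = 0 := by
    intro b hb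
    have hE := nonneg_of_mul_le_deriv (f := fun t => -(y t ^ 2 / 2 + x t ^ 4 / 4)) (a := t₀)
      (k := fun t => 2 * (|α| * x t ^ 2 + y t ^ 2)) (b := b) (by fun_prop)
      (fun t _ => (hs.hasDerivAt_energy t).neg) (by fun_prop) (by simp [hx, hy])
      (fun t _ _ => by
        have h1 : 0 ≤ (|α| - α) * (x t ^ 2 * y t ^ 2) :=
          mul_nonneg (sub_nonneg.2 (le_abs_self α)) (by positivity)
        have h2 : 0 ≤ (|α| * x t ^ 2 + y t ^ 2) * x t ^ 4 := by positivity
        linarith) b ⟨hb, le_rfl⟩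
    have h1 : 0 ≤ y b ^ 2 / 2 := by positivity
    have h2 : 0 ≤ x b ^ 4 / 4 := by positivity
    exact ⟨pow_eq_zero_iff (n := 4) (by norm_num) |>.1 (by linarith),
      pow_eq_zero_iff (n := 2) (by norm_num) |>.1 (by linarith)⟩
  have hzero' : ∀ t, x t = 0 ∧ y t = 0 := by
    intro t
    obtain ⟨s, h1, h2, h3⟩ := hp.exists_ge t₀ t
    rw [← h2, ← h3]
    exact hzero s h1
  obtain ⟨t, s, hts⟩ := hn
  exact hts (by rw [(hzero' t).1, (hzero' t).2, (hzero' s).1, (hzero' s).2])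

theorem IsSolXY.neg {α : ℝ} {x y : ℝ → ℝ} (hs : IsSolXY α x y) :
    IsSolXY α (fun t => -x t) fun t => -y t := fun t =>
  ⟨(hs t).1.neg, (hs t).2.neg.congr_deriv (by ring)⟩

theorem IsPeriodicSol.neg {x y : ℝ → ℝ} (hp : IsPeriodicSol x y) :
    IsPeriodicSol (fun t => -x t) fun t => -y t := by
  obtain ⟨T, hT, h⟩ := hp
  exact ⟨T, hT, fun t => ⟨congrArg Neg.neg (h t).1, congrArg Neg.neg (h t).2⟩⟩

theorem IsPeriodicSol.exists_isMax {x y : ℝ → ℝ} (hp : IsPeriodicSol x y) (hx : Continuous x) :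
    ∃ t₀, ∀ t, x t ≤ x t₀ := by
  obtain ⟨T, hT, h⟩ := hp
  obtain ⟨t₀, -, ht₀⟩ := (isCompact_Icc (a := 0) (b := 0 + T)).exists_isMaxOn
    ⟨0, le_rfl, by linarith⟩ hx.continuousOn
  refine ⟨t₀, fun t => ?_⟩
  have hper : Function.Periodic x T := fun t => (h t).1
  obtain ⟨s, hs, hst⟩ := hper.exists_mem_Ico hT t 0
  rw [hst]
  exact ht₀ (Set.Ico_subset_Icc_self hs)

/-- A periodic orbit whose maximal abscissa dominates yields an arc over an interval
`(-X₁, X₂)`, in the variable `z = 1 / y` as a function of `x`. -/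
theorem exists_arc_of_max {α tM tm : ℝ} {x y : ℝ → ℝ} (hs : IsSolXY α x y)
    (hp : IsPeriodicSol x y) (hne : ∀ t, y t = 0 → x t ≠ 0) (hM : ∀ t, x t ≤ x tM)
    (hm : ∀ t, x tm ≤ x t) (hmM : -x tm ≤ x tM) :
    ∃ (X₁ X₂ : ℝ) (Z : ℝ → ℝ), 0 < X₁ ∧ X₁ ≤ X₂ ∧
      (∀ s ∈ Set.Ioo (-X₁) X₂,
        0 < Z s ∧ HasDerivAt Z ((s * Z s) ^ 3 + -α * (s * Z s) ^ 2 - 1) s) ∧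
      Tendsto Z (𝓝[>] (-X₁)) atTop := by
  have hxc : Continuous x := continuous_iff_continuousAt.2 fun t => (hs t).1.continuousAt
  have hyc : Continuous y := continuous_iff_continuousAt.2 fun t => (hs t).2.continuousAt
  obtain ⟨P, hP, hper⟩ := hp
  have hyM : y tM = 0 :=
    IsLocalMax.hasDerivAt_eq_zero (Eventually.of_forall hM) (hs tM).1
  have hxM : 0 < x tM := lt_of_le_of_ne (by linarith [hM tm]) (hne tM hyM).symm
  obtain ⟨c, hcP, hcM, hc⟩ : ∃ c, tM - P < c ∧ c < tM ∧ ∀ t ∈ Set.Ico c tM, 0 < y t := by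
    have h1 := (hasDerivAt_iff_tendsto_slope.1 (hs tM).2).mono_left (nhdsLT_le_nhdsNE tM)
    have h2 : -x tM ^ 3 + α * x tM ^ 2 * y tM + y tM ^ 3 < 0 := by
      have := pow_pos hxM 3
      rw [hyM]
      linarith
    obtain ⟨c, hcM : c < tM, hc⟩ := mem_nhdsLT_iff_exists_Ico_subset.1
      ((h1.eventually_lt_const h2).and (Ioo_mem_nhdsLT (show tM - P < tM by linarith)))
    refine ⟨c, (hc ⟨le_rfl, hcM⟩).2.1, hcM, fun t ht => ?_⟩
    have h3 := (hc ht).1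
    rw [slope_def_field, hyM, sub_zero] at h3
    rcases div_neg_iff.1 h3 with h | h
    · exact h.1
    · linarith [ht.2, h.2]
  obtain ⟨t₀, ⟨ht₀I, ht₀⟩, hgr⟩ := ((isCompact_Icc (a := tM - P) (b := c)).inter_right
    (isClosed_Iic.preimage hyc : IsClosed (y ⁻¹' Set.Iic 0))).exists_isGreatest
      ⟨tM - P, ⟨le_rfl, hcP.le⟩, by
        have := (hper (tM - P)).2
        rw [sub_add_cancel] at this
        exact (this.symm.trans hyM).le⟩
  have ht₀c : t₀ < c := lt_of_le_of_ne ht₀I.2 (by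
    rintro rfl
    exact absurd ht₀ (not_le.2 (hc t₀ ⟨le_rfl, hcM⟩)))
  have hpos : ∀ t ∈ Set.Ioo t₀ tM, 0 < y t := by
    intro t ht
    rcases lt_or_ge t c with h | h
    · by_contra! hcon
      exact absurd (hgr ⟨⟨ht₀I.1.trans ht.1.le, h.le⟩, hcon⟩) (not_le.2 ht.1)
    · exact hc t ⟨h, ht.2⟩
  have ht₀M : t₀ < tM := ht₀c.trans hcM
  have hev : ∀ᶠ t in 𝓝[>] t₀, t ∈ Set.Ioo t₀ tM := Ioo_mem_nhdsGT ht₀M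
  have hy₀ : y t₀ = 0 := le_antisymm ht₀
    (ge_of_tendsto (hyc.tendsto t₀ |>.mono_left nhdsWithin_le_nhds)
      (hev.mono fun t ht => (hpos t ht).le))
  have hx₀ : x t₀ < 0 := by
    have h1 := (hasDerivAt_iff_tendsto_slope.1 (hs t₀).2).mono_left (nhdsGT_le_nhdsNE t₀)
    have h2 : 0 ≤ -x t₀ ^ 3 + α * x t₀ ^ 2 * y t₀ + y t₀ ^ 3 := by
      refine ge_of_tendsto h1 (hev.mono fun t ht => ?_)
      rw [slope_def_field, hy₀, sub_zero]
      exact div_nonneg (hpos t ht).le (by linarith [ht.1])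
    rw [hy₀] at h2
    by_contra! h3
    have h4 : 0 < x t₀ := lt_of_le_of_ne h3 (hne t₀ hy₀).symm
    have := pow_pos h4 3
    linarith
  obtain ⟨T, hTc, hT, hTd⟩ := exists_inverse_hasDerivAt ht₀M.le hxc.continuousOn
    (fun t _ => (hs t).1) hpos
  have hTx₀ : T (x t₀) = t₀ := by
    have hmono : StrictMonoOn x (Set.Icc t₀ tM) := by
      refine strictMonoOn_of_deriv_pos (convex_Icc _ _) hxc.continuousOn fun t ht => ?_
      rw [interior_Icc] at ht
      rw [(hs t).1.deriv]
      exact hpos t ht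
    obtain ⟨h1, h2⟩ := hT (x t₀) ⟨le_rfl, hM t₀⟩
    exact hmono.injOn h1 ⟨le_rfl, ht₀M.le⟩ h2
  refine ⟨-x t₀, x tM, fun s => (y (T s))⁻¹, by linarith, by linarith [hm t₀], ?_, ?_⟩
  · intro s hsI
    rw [neg_neg] at hsI
    obtain ⟨h1, h2⟩ := hTd s hsI
    have h3 := hpos _ h1
    refine ⟨inv_pos.2 h3, ((((hs (T s)).2).comp s h2).inv h3.ne').congr_deriv ?_⟩
    rw [(hT s (Set.Ioo_subset_Icc_self hsI)).2]
    have := h3.ne'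
    simp only [Function.comp]
    field_simp
    ring
  · rw [neg_neg]
    refine Tendsto.inv_tendsto_nhdsGT_zero (f := fun s => y (T s))
      (tendsto_nhdsWithin_iff.2 ⟨?_, ?_⟩)
    · have := (hyc.comp hTc).tendsto (x t₀)
      simp only [Function.comp, hTx₀, hy₀] at this
      exact this.mono_left nhdsWithin_le_nhds
    · filter_upwards [Ioo_mem_nhdsGT (hx₀.trans hxM)] with s hsI
      exact hpos _ (hTd s hsI).1

/-- A nonconstant periodic orbit yields an arc over an interval `(-X₁, X₂)` with `X₁ ≤ X₂`. -/
theorem exists_arc_of_periodic {α : ℝ} {x y : ℝ → ℝ} (hs : IsSolXY α x y)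
    (hp : IsPeriodicSol x y) (hn : NonconstSol x y) :
    ∃ (X₁ X₂ : ℝ) (Z : ℝ → ℝ), 0 < X₁ ∧ X₁ ≤ X₂ ∧
      (∀ s ∈ Set.Ioo (-X₁) X₂,
        0 < Z s ∧ HasDerivAt Z ((s * Z s) ^ 3 + -α * (s * Z s) ^ 2 - 1) s) ∧
      Tendsto Z (𝓝[>] (-X₁)) atTop := by
  have hxc : Continuous x := continuous_iff_continuousAt.2 fun t => (hs t).1.continuousAt
  have hne := hs.ne_zero hp hn
  obtain ⟨tM, hM⟩ := hp.exists_isMax hxc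
  obtain ⟨tm, hm⟩ := hp.neg.exists_isMax hxc.neg
  rcases le_total (-x tm) (x tM) with h | h
  · exact exists_arc_of_max hs hp hne hM (fun t => neg_le_neg_iff.1 (hm t)) h
  · exact exists_arc_of_max hs.neg hp.neg
      (fun t ht => neg_ne_zero.2 (hne t (neg_eq_zero.1 ht))) hm
      (fun t => neg_le_neg (hM t)) (by simpa using h)

/-- For `α ≥ 0` the energy `y² / 2 + x⁴ / 4` is nondecreasing, so periodic solutions are constant. -/
theorem not_periodic_of_nonneg {α : ℝ} {x y : ℝ → ℝ} (hα : 0 ≤ α) (hs : IsSolXY α x y)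
    (hp : IsPeriodicSol x y) : ¬ NonconstSol x y := by
  let E : ℝ → ℝ := fun t => y t ^ 2 / 2 + x t ^ 4 / 4
  have hmono : Monotone E := monotone_of_hasDerivAt_nonneg hs.hasDerivAt_energy
    fun t => by simp only [Pi.zero_apply]; positivity
  have hle : ∀ t s, E t ≤ E s := by
    intro t s
    obtain ⟨r, h1, h2, h3⟩ := hp.exists_ge t s
    exact (hmono h1).trans_eq (by simp only [E, h2, h3])
  have hy : ∀ t, y t = 0 := by
    intro t
    have hconst : E = fun _ => E t := funext fun s => le_antisymm (hle s t) (hle t s)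
    have h1 : HasDerivAt E _ t := hs.hasDerivAt_energy t
    rw [hconst] at h1
    have h2 := h1.unique (hasDerivAt_const t (E t))
    have h3 : 0 ≤ α * (x t ^ 2 * y t ^ 2) := by positivity
    have h4 : 0 ≤ y t ^ 4 := by positivity
    exact pow_eq_zero_iff (n := 4) (by norm_num) |>.1 (by linarith)
  have hx : ∀ t s, x t = x s := is_const_of_deriv_eq_zero
    (fun t => (hs t).1.differentiableAt) fun t => by rw [(hs t).1.deriv, hy]
  rintro ⟨t, s, hts⟩
  exact hts (by rw [hx t s, hy t, hy s])

/-- For `α ≤ α*` or `α ≥ 0` (where `α*` is the unique heteroclinic parameter) the system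
`ẋ = y`, `ẏ = -x³ + αx²y + y³` has no nonconstant periodic solution. -/
theorem no_limit_cycle_outside (αs : ℝ)
    (h₁ : αs < -3 * (4 : ℝ) ^ (-(1 : ℝ) / 3)) (h₂ : HasHeteroclinic αs)
    (huniq : ∀ β : ℝ, β < -3 * (4 : ℝ) ^ (-(1 : ℝ) / 3) → HasHeteroclinic β → β = αs) :
    ∀ α : ℝ, (α ≤ αs ∨ 0 ≤ α) →
      ¬ ∃ x y : ℝ → ℝ, IsSolXY α x y ∧ IsPeriodicSol x y ∧ NonconstSol x y := by
  rintro α hα ⟨x, y, hs, hp, hn⟩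
  rcases hα with hα | hα
  · obtain ⟨ha, he, Γ, v₁, v₃, hΓ, ht, hb, hv⟩ := graph_of_heteroclinic h₁ h₂
    obtain ⟨X₁, X₂, Z, hX, hX₂, hZ, hZt⟩ := exists_arc_of_periodic hs hp hn
    exact no_arc_of_connection ha (neg_le_neg hα) he hΓ ht hb hv hX hX₂ hZ hZt
  · exact not_periodic_of_nonneg hα hs hp hn
end

section
/- Let α < −3·4^{−1/3} and let v₃⁰(α) be the largest real root of f(v,α) = 0. Suppose there exist T ∈ [−∞, +∞) and a solution (v,z) : (T, +∞) → ℝ² of the transformed system dv/dτ = v·f(v,α) + z², dz/dτ = z·f(v,α) with z(τ) > 0 for all τ, such that (v(τ), z(τ)) → (v₃⁰(α), 0) as τ → +∞ and v(τ) → −∞ as τ → T⁺. Then the system ẋ = y, ẏ = −x³ + αx²y + y³ has a nonconstant periodic solution (a limit cycle). -/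
open Filter Topology

section GlobalFlow

variable {E : Type*} [NormedAddCommGroup E] [NormedSpace ℝ E]

lemma exists_forall_hasDerivAt_of_lipschitzWith_of_bounded [CompleteSpace E] {G : E → E}
    {K L : NNReal} (hG : LipschitzWith K G) (hL : ∀ p, ‖G p‖ ≤ L) (p : E) :
    ∃ γ : ℝ → E, γ 0 = p ∧ ∀ t, HasDerivAt γ (G (γ t)) t := by
  have loc : ∀ c : ℝ, 0 < c → ∃ γ : ℝ → E, γ 0 = p ∧
      ∀ t ∈ Set.Ioo (-c) c, HasDerivAt γ (G (γ t)) t := by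
    intro c hc
    have hPL : IsPicardLindelof (fun _ => G) (tmin := -c) (tmax := c)
        ⟨0, by constructor <;> linarith⟩ p (L * c.toNNReal) 0 L K := by
      refine IsPicardLindelof.of_time_independent (fun x _ => hL x) hG.lipschitzOnWith ?_
      simp [hc.le]
    obtain ⟨γ, h0, h⟩ := hPL.exists_eq_forall_mem_Icc_hasDerivWithinAt₀
    exact ⟨γ, h0, fun t ht =>
      (h t (Set.Ioo_subset_Icc_self ht)).hasDerivAt (Icc_mem_nhds ht.1 ht.2)⟩
  choose! α hα0 hα using loc
  have agree : ∀ c : ℝ, 0 < c → ∀ t ∈ Set.Ioo (-c) c, α (|t| + 1) t = α c t := by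
    intro c hc t ht
    have htc : |t| < c := abs_lt.2 ht
    have hpos : 0 < |t| + 1 := by positivity
    set m := min c (|t| + 1) with hm
    have hmpos : 0 < m := lt_min hc hpos
    have htm : |t| < m := lt_min htc (by linarith)
    have h1 : m ≤ c := min_le_left _ _
    have h2 : m ≤ |t| + 1 := min_le_right _ _
    refine ODE_solution_unique_of_mem_Ioo (v := fun _ => G) (s := fun _ => Set.univ) (K := K)
      (a := -m) (b := m) (t₀ := 0) (fun _ _ => hG.lipschitzOnWith) ⟨by linarith, hmpos⟩
      (fun u hu => ⟨hα _ hpos u ⟨by linarith [hu.1], by linarith [hu.2]⟩, trivial⟩)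
      (fun u hu => ⟨hα _ hc u ⟨by linarith [hu.1], by linarith [hu.2]⟩, trivial⟩)
      (by rw [hα0 _ hpos, hα0 _ hc]) (abs_lt.1 htm)
  refine ⟨fun t => α (|t| + 1) t, hα0 _ (by positivity), fun t => ?_⟩
  have hpos : 0 < |t| + 1 := by positivity
  have ht : t ∈ Set.Ioo (-(|t| + 1)) (|t| + 1) := abs_lt.1 (by linarith)
  refine (hα _ hpos t ht).congr_of_eventuallyEq ?_
  filter_upwards [Ioo_mem_nhds ht.1 ht.2] with u hu using agree _ hpos u hu

lemma dist_le_dist_mul_exp_of_hasDerivAt {G : E → E} {K : NNReal} (hG : LipschitzWith K G)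
    {γ δ : ℝ → E} (hγ : ∀ t, HasDerivAt γ (G (γ t)) t) (hδ : ∀ t, HasDerivAt δ (G (δ t)) t)
    (t : ℝ) : dist (γ t) (δ t) ≤ dist (γ 0) (δ 0) * Real.exp (K * |t|) := by
  have fwd : ∀ (G : E → E) (γ δ : ℝ → E), LipschitzWith K G →
      (∀ t, HasDerivAt γ (G (γ t)) t) → (∀ t, HasDerivAt δ (G (δ t)) t) →
      ∀ t, 0 ≤ t → dist (γ t) (δ t) ≤ dist (γ 0) (δ 0) * Real.exp (K * t) := by
    intro G γ δ hG hγ hδ t ht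
    have := dist_le_of_trajectories_ODE (v := fun _ => G) (a := 0) (b := t) (fun _ => hG)
      (fun u _ => (hγ u).continuousAt.continuousWithinAt) (fun u _ => (hγ u).hasDerivWithinAt)
      (fun u _ => (hδ u).continuousAt.continuousWithinAt) (fun u _ => (hδ u).hasDerivWithinAt)
      le_rfl t ⟨ht, le_rfl⟩
    simpa using this
  have rev : ∀ γ : ℝ → E, (∀ t, HasDerivAt γ (G (γ t)) t) →
      ∀ t, HasDerivAt (fun u => γ (-u)) (-G (γ (-t))) t := by
    intro γ hγ t
    simpa [Function.comp_def] using (hγ (-t)).scomp t (hasDerivAt_neg t)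
  rcases le_total 0 t with h | h
  · rw [abs_of_nonneg h]
    exact fwd G γ δ hG hγ hδ t h
  · rw [abs_of_nonpos h]
    have := fwd (fun p => -G p) _ _ hG.neg (rev γ hγ) (rev δ hδ) (-t) (by linarith)
    simpa using this

lemma eq_of_hasDerivAt_of_lipschitzWith {G : E → E} {K : NNReal} (hG : LipschitzWith K G)
    {γ δ : ℝ → E} (hγ : ∀ t, HasDerivAt γ (G (γ t)) t) (hδ : ∀ t, HasDerivAt δ (G (δ t)) t)
    {t₀ : ℝ} (h : γ t₀ = δ t₀) : γ = δ :=
  ODE_solution_unique_univ (v := fun _ => G) (s := fun _ => Set.univ) (K := K)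
    (fun _ => hG.lipschitzOnWith) (fun t => ⟨hγ t, trivial⟩) (fun t => ⟨hδ t, trivial⟩) h

lemma exists_continuous_flow [CompleteSpace E] {G : E → E} {K L : NNReal}
    (hG : LipschitzWith K G) (hL : ∀ p, ‖G p‖ ≤ L) :
    ∃ ψ : E → ℝ → E, (∀ p, ψ p 0 = p) ∧ (∀ p t, HasDerivAt (ψ p) (G (ψ p t)) t) ∧
      Continuous fun q : E × ℝ => ψ q.1 q.2 := by
  choose ψ h0 hψ using exists_forall_hasDerivAt_of_lipschitzWith_of_bounded hG hL
  refine ⟨ψ, h0, hψ, continuous_iff_continuousAt.2 fun ⟨p, t⟩ => ?_⟩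
  have key : ContinuousOn (Function.uncurry ψ)
      (Set.univ ×ˢ Set.Icc (-(|t| + 1)) (|t| + 1)) := by
    refine continuousOn_prod_of_continuousOn_lipschitzOnWith _
      (Real.toNNReal (Real.exp (K * (|t| + 1))))
      (fun q _ u _ => (hψ q u).continuousAt.continuousWithinAt) (fun u hu => ?_)
    refine LipschitzOnWith.of_dist_le_mul fun q _ r _ => ?_
    have := dist_le_dist_mul_exp_of_hasDerivAt hG (hψ q) (hψ r) u
    rw [h0, h0] at this
    rw [Real.coe_toNNReal _ (Real.exp_pos _).le, mul_comm]
    refine this.trans ?_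
    have : |u| ≤ |t| + 1 := abs_le.2 hu
    gcongr
  refine key.continuousAt (prod_mem_nhds univ_mem ?_)
  have : t ∈ Set.Ioo (-(|t| + 1)) (|t| + 1) := abs_lt.1 (by linarith)
  exact Icc_mem_nhds this.1 this.2

end GlobalFlow

/-- The time reversal of the vector field `(y, -x³ - b x² y + y³)`. -/
def revField (b : ℝ) (p : ℝ × ℝ) : ℝ × ℝ := (-p.2, p.1 ^ 3 + b * p.1 ^ 2 * p.2 - p.2 ^ 3)

/-- Projection of the line onto the interval `[-R, R]`. -/
def clip (R u : ℝ) : ℝ := max (-R) (min R u)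

/-- The reversed field, frozen outside of the square `[-R, R]²`. -/
def clipField (b R : ℝ) (p : ℝ × ℝ) : ℝ × ℝ := revField b (clip R p.1, clip R p.2)

lemma clip_of_mem {R u : ℝ} (h1 : -R ≤ u) (h2 : u ≤ R) : clip R u = u := by
  rw [clip, min_eq_right h2, max_eq_right h1]

lemma clip_neg {R : ℝ} (hR : 0 ≤ R) (u : ℝ) : clip R (-u) = -clip R u := by
  simp only [clip, max_def, min_def]
  split_ifs <;> linarith

lemma clip_pos {R u : ℝ} (hR : 0 < R) (hu : 0 < u) : 0 < clip R u :=
  lt_max_of_lt_right (lt_min hR hu)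

lemma clip_mem {R : ℝ} (hR : 0 ≤ R) (u : ℝ) : clip R u ∈ Set.Icc (-R) R :=
  ⟨le_max_left _ _, max_le (by linarith) (min_le_left _ _)⟩

lemma lipschitzWith_clip (R : ℝ) : LipschitzWith 1 (clip R) :=
  (LipschitzWith.id.const_min R).const_max (-R)

lemma clipField_neg {b R : ℝ} (hR : 0 ≤ R) (p : ℝ × ℝ) :
    clipField b R (-p) = -clipField b R p := by
  simp only [clipField, revField, Prod.fst_neg, Prod.snd_neg, clip_neg hR, Prod.neg_mk]
  ext
  · simp
  · simp
    ring

lemma clipField_of_mem {b R : ℝ} {p : ℝ × ℝ} (h1 : p.1 ∈ Set.Icc (-R) R)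
    (h2 : p.2 ∈ Set.Icc (-R) R) : clipField b R p = revField b p := by
  rw [clipField, clip_of_mem h1.1 h1.2, clip_of_mem h2.1 h2.2]

lemma contDiff_revField (b : ℝ) : ContDiff ℝ 1 (revField b) := by
  unfold revField
  fun_prop

lemma exists_lipschitzWith_clipField (b : ℝ) {R : ℝ} (hR : 0 ≤ R) :
    ∃ K, LipschitzWith K (clipField b R) := by
  have hcomp : IsCompact (Set.Icc (-R) R ×ˢ Set.Icc (-R) R) := isCompact_Icc.prod isCompact_Icc
  obtain ⟨K, hK⟩ := ((contDiff_revField b).locallyLipschitz.locallyLipschitzOn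
    (s := Set.Icc (-R) R ×ˢ Set.Icc (-R) R)).exists_lipschitzOnWith_of_compact hcomp
  have hclip : LipschitzWith 1 fun p : ℝ × ℝ => (clip R p.1, clip R p.2) := by
    have h1 := (lipschitzWith_clip R).comp (LipschitzWith.prod_fst (α := ℝ) (β := ℝ))
    have h2 := (lipschitzWith_clip R).comp (LipschitzWith.prod_snd (α := ℝ) (β := ℝ))
    simpa [Function.comp_def] using h1.prodMk h2
  refine ⟨K * 1, ?_⟩
  rw [← lipschitzOnWith_univ] at hclip ⊢
  exact hK.comp hclip fun p _ => ⟨clip_mem hR _, clip_mem hR _⟩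

lemma exists_norm_clipField_le (b : ℝ) {R : ℝ} (hR : 0 ≤ R) :
    ∃ L : NNReal, ∀ p, ‖clipField b R p‖ ≤ L := by
  have hcomp : IsCompact (Set.Icc (-R) R ×ˢ Set.Icc (-R) R) := isCompact_Icc.prod isCompact_Icc
  obtain ⟨C, hC⟩ := hcomp.exists_bound_of_continuousOn (contDiff_revField b).continuous.continuousOn
  refine ⟨C.toNNReal, fun p => ?_⟩
  exact (hC _ ⟨clip_mem hR p.1, clip_mem hR p.2⟩).trans (Real.le_coe_toNNReal C)


lemma le_of_forall_hasDerivAt_nonneg {f f' : ℝ → ℝ} {s t : ℝ} (hst : s ≤ t)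
    (hf : ∀ u ∈ Set.Icc s t, HasDerivAt f (f' u) u) (h : ∀ u ∈ Set.Icc s t, 0 ≤ f' u) :
    f s ≤ f t := by
  refine monotoneOn_of_deriv_nonneg (convex_Icc s t)
    (fun u hu => (hf u hu).continuousAt.continuousWithinAt)
    (fun u hu => (hf u (interior_subset hu)).differentiableAt.differentiableWithinAt)
    (fun u hu => ?_) (Set.left_mem_Icc.2 hst) (Set.right_mem_Icc.2 hst) hst
  rw [(hf u (interior_subset hu)).deriv]
  exact h u (interior_subset hu)

lemma exists_lt_of_forall_hasDerivAt_ge {f f' : ℝ → ℝ} {c t₀ : ℝ} (hc : 0 < c)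
    (hf : ∀ u, t₀ ≤ u → HasDerivAt f (f' u) u) (h : ∀ u, t₀ ≤ u → c ≤ f' u) (C : ℝ) :
    ∃ t, t₀ ≤ t ∧ C < f t := by
  set t := t₀ + (|C - f t₀| + 1) / c with ht
  have hle : t₀ ≤ t := by
    have : 0 ≤ (|C - f t₀| + 1) / c := by positivity
    linarith
  refine ⟨t, hle, ?_⟩
  have key := le_of_forall_hasDerivAt_nonneg (f := fun u => f u - c * u)
    (f' := fun u => f' u - c) hle
    (fun u hu => by
      simpa using (hf u hu.1).fun_sub ((hasDerivAt_id u).const_mul c))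
    (fun u hu => by linarith [h u hu.1])
  have h1 : c * (t - t₀) = |C - f t₀| + 1 := by
    rw [ht, add_sub_cancel_left]
    field_simp
  have h2 := le_abs_self (C - f t₀)
  nlinarith

lemma not_forall_pos_of_revField {b a M : ℝ} (hb : 0 < b) {x y : ℝ → ℝ}
    (hx : ∀ t, 0 < t → HasDerivAt x (-y t) t)
    (hy : ∀ t, 0 < t → HasDerivAt y (x t ^ 3 + b * x t ^ 2 * y t - y t ^ 3) t)
    (hpos : ∀ t, 0 < t → 0 < y t) (hxa : ∀ t, 0 < t → -a ≤ x t) (hyM : ∀ t, 0 < t → y t ≤ M) :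
    False := by
  have hM : 0 < M := (hpos 1 one_pos).trans_le (hyM 1 one_pos)
  have xanti : ∀ s t, 0 < s → s ≤ t → x t ≤ x s := by
    intro s t hs hst
    have := le_of_forall_hasDerivAt_nonneg (f := fun u => -x u) (f' := y) hst
      (fun u hu => by simpa using (hx u (hs.trans_le hu.1)).fun_neg)
      (fun u hu => (hpos u (hs.trans_le hu.1)).le)
    linarith
  have y_not_bddBelow : ∀ c, 0 < c → ∀ t₀, 0 < t₀ → ¬ ∀ t, t₀ ≤ t → c ≤ y t := by
    intro c hc t₀ ht₀ h
    obtain ⟨t, ht, hlt⟩ := exists_lt_of_forall_hasDerivAt_ge (f := fun u => -x u) (f' := y) hc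
      (fun u hu => by simpa using (hx u (ht₀.trans_le hu)).fun_neg) h a
    linarith [hxa t (ht₀.trans_le ht)]
  have hcube : ∀ t, 0 < t → HasDerivAt (fun u => b * x u ^ 3 / 3) (-(b * x t ^ 2 * y t)) t := by
    intro t ht
    have := (((hx t ht).pow 3).const_mul b).div_const 3
    exact this.congr_deriv (by push_cast; ring)
  by_cases hneg : ∃ t, 0 < t ∧ x t < 0
  · obtain ⟨t₀, ht₀, hlt⟩ := hneg
    obtain ⟨t, ht, hC⟩ := exists_lt_of_forall_hasDerivAt_ge
      (f := fun u => -(y u + b * x u ^ 3 / 3)) (f' := fun u => -(x u ^ 3 - y u ^ 3))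
      (c := (-x t₀) ^ 3) (by have : 0 < -x t₀ := by linarith
                             positivity)
      (fun u hu => by
        have h := ((hy u (ht₀.trans_le hu)).fun_add (hcube u (ht₀.trans_le hu))).fun_neg
        exact h.congr_deriv (by ring))
      (fun u hu => by
        have h1 : -x t₀ ≤ -x u := by linarith [xanti t₀ u ht₀ hu]
        have h2 : (-x t₀) ^ 3 ≤ (-x u) ^ 3 := by
          have : 0 ≤ -x t₀ := by linarith
          gcongr
        have h3 : 0 < y u ^ 3 := pow_pos (hpos u (ht₀.trans_le hu)) 3
        nlinarith)
      (b * a ^ 3 / 3)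
    have ht' := ht₀.trans_le ht
    have h1 : -x t ≤ a := by linarith [hxa t ht']
    have h0 : 0 ≤ -x t := by linarith [xanti t₀ t ht₀ ht]
    have h2 : (-x t) ^ 3 ≤ a ^ 3 := by gcongr
    have h3 := hpos t ht'
    have h4 : b * (-x t) ^ 3 ≤ b * a ^ 3 := by gcongr
    have h5 : (-x t) ^ 3 = -x t ^ 3 := by ring
    rw [h5] at h4
    linarith
  · push Not at hneg
    have trap : ∀ m t₀, 0 < t₀ → 0 < m → (∀ t, t₀ ≤ t → y t ^ 2 ≤ m) →
        ∀ t, t₀ ≤ t → y t ≤ m * x t := by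
      intro m t₀ ht₀ hm hym t ht
      by_contra! hlt
      have ht' := ht₀.trans_le ht
      refine y_not_bddBelow (y t - m * x t) (by linarith) t ht' fun u hu => ?_
      have := le_of_forall_hasDerivAt_nonneg (f := fun u => y u - m * x u)
        (f' := fun u => x u ^ 3 + b * x u ^ 2 * y u - y u ^ 3 - m * (-y u)) hu
        (fun r hr => (hy r (ht'.trans_le hr.1)).sub ((hx r (ht'.trans_le hr.1)).const_mul m))
        (fun r hr => by
          have hr0 := ht'.trans_le hr.1
          have h1 := hneg r hr0
          have h2 := hpos r hr0
          have h3 := hym r (ht.trans hr.1)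
          have h4 : 0 ≤ y r * (m - y r ^ 2) := mul_nonneg h2.le (by linarith)
          have h5 : 0 ≤ x r ^ 3 + b * x r ^ 2 * y r := by positivity
          nlinarith)
      have h6 : 0 ≤ m * x u := mul_nonneg hm.le (hneg u (ht'.trans_le hu))
      linarith
    have hsmall : ∃ t₀, 0 < t₀ ∧ M ^ 2 * x t₀ ≤ 1 := by
      by_contra! hbig
      obtain ⟨t, ht, hC⟩ := exists_lt_of_forall_hasDerivAt_ge (t₀ := 1)
        (f := fun u => y u - M ^ 2 * x u)
        (f' := fun u => x u ^ 3 + b * x u ^ 2 * y u - y u ^ 3 - M ^ 2 * (-y u))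
        (c := (1 / M ^ 2) ^ 3) (by positivity)
        (fun r hr => (hy r (by linarith)).sub ((hx r (by linarith)).const_mul _))
        (fun r hr => by
          have hr0 : 0 < r := by linarith
          have h1 : 1 / M ^ 2 ≤ x r := by
            rw [div_le_iff₀ (by positivity)]
            linarith [hbig r hr0]
          have h2 := hpos r hr0
          have h3 : y r ^ 2 ≤ M ^ 2 := by
            have := hyM r hr0
            gcongr
          have h4 : 0 ≤ y r * (M ^ 2 - y r ^ 2) := mul_nonneg h2.le (by linarith)
          have h5 : 0 ≤ b * x r ^ 2 * y r := by positivity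
          have h6 : (1 / M ^ 2) ^ 3 ≤ x r ^ 3 := by gcongr
          nlinarith)
        M
      have ht' : 0 < t := by linarith
      have := mul_nonneg (sq_nonneg M) (hneg t ht')
      linarith [hyM t ht']
    obtain ⟨t₀, ht₀, hxt₀⟩ := hsmall
    have hy1 : ∀ t, t₀ ≤ t → y t ≤ 1 := by
      intro t ht
      have h1 := trap (M ^ 2) t₀ ht₀ (by positivity) (fun u hu => by
        have h0 := (hpos u (ht₀.trans_le hu)).le
        have := hyM u (ht₀.trans_le hu)
        gcongr) t ht
      have h2 : M ^ 2 * x t ≤ M ^ 2 * x t₀ := by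
        have := xanti t₀ t ht₀ ht
        gcongr
      linarith
    have hyx := trap 1 t₀ ht₀ one_pos (fun u hu =>
      pow_le_one₀ (hpos u (ht₀.trans_le hu)).le (hy1 u hu))
    refine y_not_bddBelow (y t₀) (hpos t₀ ht₀) t₀ ht₀ fun t ht => ?_
    refine le_of_forall_hasDerivAt_nonneg ht (fun r hr => hy r (ht₀.trans_le hr.1)) fun r hr => ?_
    have hr0 := ht₀.trans_le hr.1
    have h2 := (hpos r hr0).le
    have h3 : y r ≤ x r := by simpa using hyx r hr.1
    have h4 : y r ^ 3 ≤ x r ^ 3 := by gcongr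
    have h5 : 0 ≤ b * x r ^ 2 * y r := by positivity
    linarith

lemma sq_le_sq_of_revField_halfTurn {b s M h : ℝ} (hs : 0 < s) (hsb : s ^ 2 ≤ b / 12)
    (hsM : s * M ≤ 1 / 12) (hh : 0 ≤ h) {x y : ℝ → ℝ}
    (hx : ∀ t ∈ Set.Icc 0 h, HasDerivAt x (-y t) t)
    (hy : ∀ t ∈ Set.Icc 0 h, HasDerivAt y (x t ^ 3 + b * x t ^ 2 * y t - y t ^ 3) t)
    (hy0 : ∀ t ∈ Set.Icc 0 h, 0 ≤ y t) (hyM : ∀ t ∈ Set.Icc 0 h, y t ≤ M)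
    (hxs : ∀ t ∈ Set.Icc 0 h, |x t| ≤ s) (h1 : x 0 = s) (h2 : y 0 = 0) (h3 : y h = 0) :
    s ^ 4 ≤ x h ^ 4 := by
  have key := le_of_forall_hasDerivAt_nonneg
    (f := fun u => y u ^ 2 / 2 + x u ^ 4 / 4 - 2 * (x u * y u ^ 3))
    (f' := fun u => y u ^ 2 * (b * x u ^ 2 + y u ^ 2 - 6 * x u ^ 4 - 6 * b * x u ^ 3 * y u
      + 6 * x u * y u ^ 3)) hh
    (fun u hu => by
      have := ((((hy u hu).pow 2).div_const 2).add (((hx u hu).pow 4).div_const 4)).sub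
        (((hx u hu).mul ((hy u hu).pow 3)).const_mul 2)
      exact this.congr_deriv (by simp only [Pi.pow_apply]; push_cast; ring))
    (fun u hu => by
      have hM : y u * s ≤ 1 / 12 :=
        (mul_le_mul_of_nonneg_right (hyM u hu) hs.le).trans (by linarith)
      have hxy : |x u * y u| ≤ 1 / 12 := by
        rw [abs_mul, abs_of_nonneg (hy0 u hu)]
        nlinarith [hxs u hu, hy0 u hu]
      have hxx : x u ^ 2 ≤ b / 12 := by
        have := sq_le_sq' (abs_le.1 (hxs u hu)).1 (abs_le.1 (hxs u hu)).2
        linarith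
      have hb : 0 ≤ b := by nlinarith [sq_nonneg s]
      obtain ⟨h4, h5⟩ := abs_le.1 hxy
      refine mul_nonneg (sq_nonneg _) ?_
      have e1 : 0 ≤ x u ^ 2 * (b / 12 - x u ^ 2) := mul_nonneg (sq_nonneg _) (by linarith)
      have e2 : 0 ≤ b * x u ^ 2 * (1 / 12 - x u * y u) :=
        mul_nonneg (mul_nonneg hb (sq_nonneg _)) (by linarith)
      have e3 : 0 ≤ y u ^ 2 * (1 / 12 + x u * y u) := mul_nonneg (sq_nonneg _) (by linarith)
      have e4 : 0 ≤ b * x u ^ 2 := mul_nonneg hb (sq_nonneg _)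
      nlinarith [sq_nonneg (y u)])
  simp only [h1, h2, h3] at key
  linarith

/-- `Y` is the graph, over `(-a, ∞)`, of an orbit of `(y, -x³ - b x² y + y³)` in the upper
half-plane. -/
def IsOrbitGraph (b a : ℝ) (Y : ℝ → ℝ) : Prop :=
  ∀ x, -a < x → 0 < Y x ∧ HasDerivAt Y ((-x ^ 3 - b * x ^ 2 * Y x + Y x ^ 3) / Y x) x

lemma hasDerivAt_fst {γ : ℝ → ℝ × ℝ} {p : ℝ × ℝ} {t : ℝ} (h : HasDerivAt γ p t) :
    HasDerivAt (fun u => (γ u).1) p.1 t := by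
  simpa using h.hasFDerivAt.fst.hasDerivAt

lemma hasDerivAt_snd {γ : ℝ → ℝ × ℝ} {p : ℝ × ℝ} {t : ℝ} (h : HasDerivAt γ p t) :
    HasDerivAt (fun u => (γ u).2) p.2 t := by
  simpa using h.hasFDerivAt.snd.hasDerivAt

lemma IsOrbitGraph.lt_of_revField {b a M h : ℝ} {Y : ℝ → ℝ} (hY : IsOrbitGraph b a Y)
    (hYM : ∀ x, -a < x → x ≤ a → Y x ≤ M) (hh : 0 ≤ h) {x y : ℝ → ℝ}
    (hxc : ContinuousOn x (Set.Icc 0 h)) (hyc : ContinuousOn y (Set.Icc 0 h))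
    (hder : ∀ t ∈ Set.Ioo 0 h, y t ≤ M → HasDerivAt x (-y t) t ∧
      HasDerivAt y (x t ^ 3 + b * x t ^ 2 * y t - y t ^ 3) t)
    (hpos : ∀ t ∈ Set.Ioo 0 h, 0 < y t) (hxa : ∀ t ∈ Set.Icc 0 h, -a < x t ∧ x t ≤ a)
    (hy0 : y 0 < Y (x 0)) : y h < Y (x h) := by
  by_contra! hle
  have hYc : ContinuousOn (fun t => Y (x t)) (Set.Icc 0 h) := fun t ht =>
    ((hY _ (hxa t ht).1).2.continuousAt).comp_continuousWithinAt (hxc t ht)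
  have hDc : ContinuousOn (fun t => y t - Y (x t)) (Set.Icc 0 h) := hyc.sub hYc
  have hcpt : IsCompact (Set.Icc 0 h ∩ (fun t => y t - Y (x t)) ⁻¹' Set.Ici 0) :=
    isCompact_Icc.of_isClosed_subset (hDc.preimage_isClosed_of_isClosed isClosed_Icc isClosed_Ici)
      Set.inter_subset_left
  obtain ⟨r, ⟨hr, hrD⟩, hmin⟩ := hcpt.exists_isLeast
    ⟨h, ⟨hh, le_rfl⟩, by simpa using hle⟩
  simp only [Set.mem_preimage, Set.mem_Ici] at hrD
  have hsub : Set.Icc 0 r ⊆ Set.Icc 0 h := Set.Icc_subset_Icc_right hr.2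
  have hneg : ∀ t ∈ Set.Ioo 0 r, y t < Y (x t) := by
    intro t ht
    by_contra! hge
    have := hmin ⟨hsub ⟨ht.1.le, ht.2.le⟩, by simpa using hge⟩
    linarith [ht.2]
  obtain ⟨q, hq, hqmin⟩ := isCompact_Icc.exists_isMinOn (Set.nonempty_Icc.2 hr.1) (hYc.mono hsub)
  set m := Y (x q) with hm
  have hmpos : 0 < m := (hY _ (hxa q (hsub hq)).1).1
  have hmle : ∀ t ∈ Set.Icc 0 r, m ≤ Y (x t) := fun t ht => hqmin ht
  have ha : 0 < a := by linarith [(hxa 0 ⟨le_rfl, hh⟩).1, (hxa 0 ⟨le_rfl, hh⟩).2]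
  set C := a ^ 3 / m + 2 * M ^ 2 with hC
  have hanti : AntitoneOn (fun t => (y t - Y (x t)) * Real.exp (C * t)) (Set.Icc 0 r) := by
    have hd : ∀ t ∈ Set.Ioo 0 r, ∃ d ≤ 0,
        HasDerivAt (fun t => (y t - Y (x t)) * Real.exp (C * t)) d t := by
      intro t ht
      have htr : t ∈ Set.Icc 0 r := ⟨ht.1.le, ht.2.le⟩
      have hth : t ∈ Set.Ioo 0 h := ⟨ht.1, ht.2.trans_le hr.2⟩
      obtain ⟨hxl, hxu⟩ := hxa t (hsub htr)
      obtain ⟨hYpos, hYd⟩ := hY _ hxl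
      have hYM' := hYM _ hxl hxu
      have hlt := hneg t ht
      have hyt := hpos t hth
      obtain ⟨hxd, hyd⟩ := hder t hth (by linarith)
      have hexp : HasDerivAt (fun t => Real.exp (C * t)) (Real.exp (C * t) * C) t := by
        simpa using ((hasDerivAt_id t).const_mul C).exp
      refine ⟨_, ?_, (hyd.fun_sub (hYd.comp t hxd)).mul hexp⟩
      have hk : x t ^ 3 / Y (x t) + y t * (Y (x t) + y t) ≤ C := by
        have h1 : x t ^ 3 / Y (x t) ≤ a ^ 3 / m := by
          have h3 : x t ^ 3 ≤ a ^ 3 := (Odd.strictMono_pow (by decide)).monotone hxu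
          calc x t ^ 3 / Y (x t) ≤ a ^ 3 / Y (x t) := by gcongr
            _ ≤ a ^ 3 / m := by
              have := hmle t htr
              gcongr
        have h2 : y t * (Y (x t) + y t) ≤ M * (M + M) := by gcongr <;> linarith
        rw [hC]
        linarith
      have heq : (x t ^ 3 + b * x t ^ 2 * y t - y t ^ 3 -
          (-x t ^ 3 - b * x t ^ 2 * Y (x t) + Y (x t) ^ 3) / Y (x t) * -y t) *
            Real.exp (C * t) + (y t - Y (x t)) * (Real.exp (C * t) * C) =
          -((Y (x t) - y t) * (C - (x t ^ 3 / Y (x t) + y t * (Y (x t) + y t))) *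
            Real.exp (C * t)) := by
        field_simp
        ring
      refine heq.trans_le (neg_nonpos.2 ?_)
      exact mul_nonneg (mul_nonneg (by linarith) (by linarith)) (Real.exp_pos _).le
    refine antitoneOn_of_deriv_nonpos (convex_Icc 0 r)
      ((hDc.mono hsub).mul (by fun_prop)) (fun t ht => ?_) (fun t ht => ?_)
    · rw [interior_Icc] at ht
      obtain ⟨d, -, hd⟩ := hd t ht
      exact hd.differentiableAt.differentiableWithinAt
    · rw [interior_Icc] at ht
      obtain ⟨d, hd0, hd⟩ := hd t ht
      rwa [hd.deriv]
  have hfin := hanti (Set.left_mem_Icc.2 hr.1) (Set.right_mem_Icc.2 hr.1) hr.1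
  simp only [mul_zero, Real.exp_zero, mul_one] at hfin
  have : 0 ≤ (y r - Y (x r)) * Real.exp (C * r) := mul_nonneg hrD (Real.exp_pos _).le
  linarith

lemma IsOrbitGraph.mem_of_clipField {b a M R s h : ℝ} {Y : ℝ → ℝ} (hY : IsOrbitGraph b a Y)
    (hYlim : Tendsto Y (𝓝[>] (-a)) (𝓝 0)) (hYM : ∀ x, -a < x → x ≤ a → Y x ≤ M)
    (haR : a ≤ R) (hMR : M ≤ R) (hs : 0 < s) (hsa : s ≤ a) {γ : ℝ → ℝ × ℝ}
    (hγ : ∀ t, HasDerivAt γ (clipField b R (γ t)) t) (hγ0 : γ 0 = (s, 0)) (hh : 0 < h)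
    (hpos : ∀ t ∈ Set.Ioo 0 h, 0 < (γ t).2) :
    ∀ t ∈ Set.Icc 0 h, -a ≤ (γ t).1 ∧ (γ t).1 ≤ s ∧ 0 ≤ (γ t).2 ∧ (γ t).2 ≤ M := by
  have hR : 0 < R := by linarith
  have hxd : ∀ t, HasDerivAt (fun u => (γ u).1) (-clip R (γ t).2) t := fun t =>
    hasDerivAt_fst (hγ t)
  have hyd : ∀ t, HasDerivAt (fun u => (γ u).2) (clipField b R (γ t)).2 t := fun t =>
    hasDerivAt_snd (hγ t)
  have hxc : Continuous fun u => (γ u).1 := continuous_iff_continuousAt.2 fun t =>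
    (hxd t).continuousAt
  have hyc : Continuous fun u => (γ u).2 := continuous_iff_continuousAt.2 fun t =>
    (hyd t).continuousAt
  have hx0 : (γ 0).1 = s := by rw [hγ0]
  have hy0 : (γ 0).2 = 0 := by rw [hγ0]
  have hclos : ∀ S : Set ℝ, IsClosed S → Set.Ioo 0 h ⊆ S → Set.Icc 0 h ⊆ S := fun S hS hsub => by
    rw [← closure_Ioo hh.ne]
    exact hS.closure_subset_iff.2 hsub
  have hynn := hclos _ (isClosed_le continuous_const hyc) fun t ht => (hpos t ht).le
  have hanti : StrictAntiOn (fun u => (γ u).1) (Set.Icc 0 h) := by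
    refine strictAntiOn_of_deriv_neg (convex_Icc 0 h) hxc.continuousOn fun t ht => ?_
    rw [interior_Icc] at ht
    rw [(hxd t).deriv]
    exact neg_neg_of_pos (clip_pos hR (hpos t ht))
  have hxs : ∀ t ∈ Set.Icc 0 h, (γ t).1 ≤ s := fun t ht => by
    rw [← hx0]
    exact hanti.antitoneOn (Set.left_mem_Icc.2 hh.le) ht ht.1
  have hbelow : ∀ t ∈ Set.Icc 0 h, -a < (γ t).1 → (γ t).2 < Y (γ t).1 := by
    intro t ht hat
    have hsub : Set.Icc 0 t ⊆ Set.Icc 0 h := Set.Icc_subset_Icc_right ht.2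
    have hxr : ∀ r ∈ Set.Icc 0 t, -a < (γ r).1 ∧ (γ r).1 ≤ a := fun r hr =>
      ⟨hat.trans_le (hanti.antitoneOn (hsub hr) ht hr.2), (hxs r (hsub hr)).trans hsa⟩
    refine hY.lt_of_revField hYM ht.1 hxc.continuousOn hyc.continuousOn (fun r hr hrM => ?_)
      (fun r hr => hpos r ⟨hr.1, hr.2.trans_le ht.2⟩) hxr ?_
    · have h1 := hxr r ⟨hr.1.le, hr.2.le⟩
      have h2 := hpos r ⟨hr.1, hr.2.trans_le ht.2⟩
      have h3 := hγ r
      rw [clipField_of_mem ⟨by linarith, by linarith⟩ ⟨by linarith, by linarith⟩] at h3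
      exact ⟨hasDerivAt_fst h3, hasDerivAt_snd h3⟩
    · rw [hy0]
      exact (hY _ (by rw [hx0]; linarith)).1
  have hxa : ∀ t ∈ Set.Icc 0 h, -a ≤ (γ t).1 := by
    intro t ht
    by_contra! hlt
    obtain ⟨r, hr, hra⟩ : -a ∈ (fun u => (γ u).1) '' Set.Icc 0 t :=
      intermediate_value_Icc' ht.1 hxc.continuousOn ⟨hlt.le, by rw [hx0]; linarith⟩
    simp only at hra
    have hr0 : 0 < r := lt_of_le_of_ne hr.1 fun h0 => by
      rw [← h0, hx0] at hra
      linarith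
    have hrt : r < t := lt_of_le_of_ne hr.2 fun h0 => by
      rw [h0] at hra
      linarith
    have hrh : r ∈ Set.Icc 0 h := ⟨hr.1, hr.2.trans ht.2⟩
    have hev : ∀ᶠ u in 𝓝[<] r, u ∈ Set.Ioo 0 r := Ioo_mem_nhdsLT hr0
    have hgt : ∀ u ∈ Set.Ioo 0 r, -a < (γ u).1 := fun u hu => by
      rw [← hra]
      exact hanti ⟨hu.1.le, hu.2.le.trans hrh.2⟩ hrh hu.2
    have hxlim : Tendsto (fun u => (γ u).1) (𝓝[<] r) (𝓝[>] (-a)) :=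
      tendsto_nhdsWithin_iff.2
        ⟨hra ▸ hxc.continuousAt.continuousWithinAt, hev.mono hgt⟩
    have hle : (γ r).2 ≤ 0 := le_of_tendsto_of_tendsto
      (hyc.continuousAt.continuousWithinAt (s := Set.Iio r)) (hYlim.comp hxlim)
      (hev.mono fun u hu => (hbelow u ⟨hu.1.le, hu.2.le.trans hrh.2⟩ (hgt u hu)).le)
    linarith [hpos r ⟨hr0, hrt.trans_le ht.2⟩]
  have hyM := hclos _ (isClosed_le hyc continuous_const) fun t ht => by
    have htI : t ∈ Set.Icc 0 h := ⟨ht.1.le, ht.2.le⟩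
    have h1 : -a < (γ t).1 :=
      (hxa h ⟨hh.le, le_rfl⟩).trans_lt (hanti htI (Set.right_mem_Icc.2 hh.le) ht.2)
    exact (hbelow t htI h1).le.trans (hYM _ h1 ((hxs t htI).trans hsa))
  exact fun t ht => ⟨hxa t ht, hxs t ht, hynn ht, hyM ht⟩

/-- An orbit graph `Y` over `(-a, ∞)` that ends at `(-a, 0)` and is bounded by `M` over `(-a, a]`,
inside of the square `[-R, R]²`. -/
structure IsBarrier (b a M R : ℝ) (Y : ℝ → ℝ) : Prop where
  isOrbitGraph : IsOrbitGraph b a Y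
  tendsto : Tendsto Y (𝓝[>] (-a)) (𝓝 0)
  le_bound : ∀ x, -a < x → x ≤ a → Y x ≤ M
  le_radius : a ≤ R
  bound_le_radius : M ≤ R

/-- `h` is the first positive time at which `γ` leaves the upper half-plane, and it does so through
the negative horizontal half-axis. -/
structure IsFirstReturn (γ : ℝ → ℝ × ℝ) (h : ℝ) : Prop where
  pos : 0 < h
  snd_pos : ∀ t ∈ Set.Ioo 0 h, 0 < (γ t).2
  snd_eq : (γ h).2 = 0
  fst_neg : (γ h).1 < 0

section Return

variable {b a M R s h : ℝ} {Y : ℝ → ℝ} {γ : ℝ → ℝ × ℝ}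

lemma IsBarrier.hasDerivAt_revField (hB : IsBarrier b a M R Y) (hs : 0 < s) (hsa : s ≤ a)
    (hγ : ∀ t, HasDerivAt γ (clipField b R (γ t)) t) (hγ0 : γ 0 = (s, 0)) (hh : 0 < h)
    (hpos : ∀ t ∈ Set.Ioo 0 h, 0 < (γ t).2) {t : ℝ} (ht : t ∈ Set.Icc 0 h) :
    HasDerivAt γ (revField b (γ t)) t := by
  obtain ⟨h1, h2, h3, h4⟩ := hB.isOrbitGraph.mem_of_clipField hB.tendsto hB.le_bound hB.le_radius
    hB.bound_le_radius hs hsa hγ hγ0 hh hpos t ht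
  have := hB.le_radius
  have := hB.bound_le_radius
  have key := hγ t
  rwa [clipField_of_mem ⟨by linarith, by linarith⟩ ⟨by linarith, by linarith⟩] at key

lemma IsBarrier.exists_isFirstReturn (hB : IsBarrier b a M R Y) (hb : 0 < b) (hs : 0 < s)
    (hsa : s ≤ a) (hγ : ∀ t, HasDerivAt γ (clipField b R (γ t)) t) (hγ0 : γ 0 = (s, 0)) :
    ∃ h, IsFirstReturn γ h := by
  have hR : 0 < R := by linarith [hB.le_radius]
  have hyd : ∀ t, HasDerivAt (fun u => (γ u).2) (clipField b R (γ t)).2 t := fun t =>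
    hasDerivAt_snd (hγ t)
  have hyc : Continuous fun u => (γ u).2 := continuous_iff_continuousAt.2 fun t =>
    (hyd t).continuousAt
  have hinit : ∃ δ > 0, ∀ t ∈ Set.Ioo 0 δ, 0 < (γ t).2 := by
    have hd := hyd 0
    rw [hγ0, clipField_of_mem ⟨by linarith, hsa.trans hB.le_radius⟩ ⟨by simp [hR.le], hR.le⟩] at hd
    have hev := eventually_nhdsWithin_sign_eq_of_deriv_pos
      (by rw [hd.deriv]; simp [revField, hs]) (by rw [hγ0])
    obtain ⟨δ, hδ, hball⟩ := Metric.eventually_nhds_iff.1 hev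
    refine ⟨δ, hδ, fun t ht => ?_⟩
    have := hball (y := t) (by rw [Real.dist_eq, sub_zero, abs_of_pos ht.1]; exact ht.2)
    rwa [sub_zero, sign_pos ht.1, sign_eq_one_iff] at this
  obtain ⟨δ, hδ, hδpos⟩ := hinit
  by_cases hex : ∃ t, 0 < t ∧ (γ t).2 ≤ 0
  · obtain ⟨t₁, ht₁, hyt₁⟩ := hex
    have hδt₁ : δ ≤ t₁ := by
      by_contra! hlt
      exact absurd hyt₁ (not_le.2 (hδpos t₁ ⟨ht₁, hlt⟩))
    have hcpt : IsCompact (Set.Icc (δ / 2) t₁ ∩ {t | (γ t).2 ≤ 0}) :=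
      isCompact_Icc.inter_right (isClosed_le hyc continuous_const)
    obtain ⟨h, ⟨hh, hyh⟩, hmin⟩ := hcpt.exists_isLeast ⟨t₁, ⟨by linarith, le_rfl⟩, hyt₁⟩
    have hh0 : 0 < h := by linarith [hh.1]
    have hpos : ∀ t ∈ Set.Ioo 0 h, 0 < (γ t).2 := by
      intro t ht
      rcases lt_or_ge t δ with hlt | hge
      · exact hδpos t ⟨ht.1, hlt⟩
      · by_contra! hle
        have := hmin ⟨⟨by linarith, ht.2.le.trans hh.2⟩, hle⟩
        linarith [ht.2]
    have hy0 : (γ h).2 = 0 := by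
      refine le_antisymm hyh ?_
      have := (isClosed_le continuous_const hyc).closure_subset_iff.2 fun t ht => (hpos t ht).le
      rw [closure_Ioo hh0.ne] at this
      exact this ⟨hh0.le, le_rfl⟩
    have hd := hasDerivAt_snd
      (hB.hasDerivAt_revField hs hsa hγ hγ0 hh0 hpos (Set.right_mem_Icc.2 hh0.le))
    have hx : (γ h).1 ≤ 0 := by
      by_contra! hx
      have hev := eventually_nhdsWithin_sign_eq_of_deriv_pos
        (by rw [hd.deriv]; simp [revField, hy0, hx]) hy0
      obtain ⟨ε, hε, hball⟩ := Metric.eventually_nhds_iff.1 hev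
      obtain ⟨t, ht1, ht2⟩ := exists_between (max_lt hh0 (sub_lt_self h hε))
      have h1 := (max_lt_iff.1 ht1).1
      have h2 := (max_lt_iff.1 ht1).2
      have := hball (y := t) (by rw [Real.dist_eq, abs_sub_lt_iff]; constructor <;> linarith)
      rw [sign_neg (by linarith : t - h < 0), sign_eq_neg_one_iff] at this
      linarith [hpos t ⟨h1, ht2⟩]
    refine ⟨h, hh0, hpos, hy0, lt_of_le_of_ne hx fun hx0 => ?_⟩
    obtain ⟨K, hK⟩ := exists_lipschitzWith_clipField b hR.le
    have hzero : clipField b R 0 = 0 := by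
      rw [clipField_of_mem (by simp [hR.le]) (by simp [hR.le])]
      simp [revField]
    have heq := eq_of_hasDerivAt_of_lipschitzWith hK hγ (δ := fun _ => 0) (t₀ := h)
      (fun t => by rw [hzero]; exact hasDerivAt_const t 0) (Prod.ext hx0 hy0)
    rw [heq] at hγ0
    exact hs.ne (congrArg Prod.fst hγ0)
  · push Not at hex
    have hmem : ∀ t, 0 < t → -a ≤ (γ t).1 ∧ (γ t).1 ≤ s ∧ 0 ≤ (γ t).2 ∧ (γ t).2 ≤ M :=
      fun t ht => hB.isOrbitGraph.mem_of_clipField hB.tendsto hB.le_bound hB.le_radius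
        hB.bound_le_radius hs hsa hγ hγ0 ht (fun u hu => hex u hu.1) t ⟨ht.le, le_rfl⟩
    have hrev : ∀ t, 0 < t → HasDerivAt γ (revField b (γ t)) t := fun t ht =>
      hB.hasDerivAt_revField hs hsa hγ hγ0 ht (fun u hu => hex u hu.1) ⟨ht.le, le_rfl⟩
    exact (not_forall_pos_of_revField hb (fun t ht => hasDerivAt_fst (hrev t ht))
      (fun t ht => hasDerivAt_snd (hrev t ht)) hex (fun t ht => (hmem t ht).1)
      (fun t ht => (hmem t ht).2.2.2)).elim

lemma IsBarrier.le_of_isFirstReturn (hB : IsBarrier b a M R Y) (hs : 0 < s) (hsa : s ≤ a)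
    (hγ : ∀ t, HasDerivAt γ (clipField b R (γ t)) t) (hγ0 : γ 0 = (s, 0))
    (hret : IsFirstReturn γ h) : -a ≤ (γ h).1 :=
  (hB.isOrbitGraph.mem_of_clipField hB.tendsto hB.le_bound hB.le_radius hB.bound_le_radius hs hsa
    hγ hγ0 hret.pos hret.snd_pos h ⟨hret.pos.le, le_rfl⟩).1

lemma IsBarrier.le_neg_of_small (hB : IsBarrier b a M R Y) (hs : 0 < s) (hsa : s ≤ a)
    (hsb : s ^ 2 ≤ b / 12) (hsM : s * M ≤ 1 / 12)
    (hγ : ∀ t, HasDerivAt γ (clipField b R (γ t)) t) (hγ0 : γ 0 = (s, 0))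
    (hret : IsFirstReturn γ h) : (γ h).1 ≤ -s := by
  by_contra! hlt
  have hmem := hB.isOrbitGraph.mem_of_clipField hB.tendsto hB.le_bound hB.le_radius
    hB.bound_le_radius hs hsa hγ hγ0 hret.pos hret.snd_pos
  have hrev : ∀ t ∈ Set.Icc 0 h, HasDerivAt γ (revField b (γ t)) t := fun t ht =>
    hB.hasDerivAt_revField hs hsa hγ hγ0 hret.pos hret.snd_pos ht
  have hge : ∀ t ∈ Set.Icc 0 h, (γ h).1 ≤ (γ t).1 := fun t ht => by
    have := le_of_forall_hasDerivAt_nonneg (f := fun u => -(γ u).1) (f' := fun u => (γ u).2) ht.2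
      (fun u hu => by
        simpa [revField] using (hasDerivAt_fst (hrev u ⟨ht.1.trans hu.1, hu.2⟩)).fun_neg)
      (fun u hu => (hmem u ⟨ht.1.trans hu.1, hu.2⟩).2.2.1)
    linarith
  have key := sq_le_sq_of_revField_halfTurn hs hsb hsM hret.pos.le
    (fun t ht => hasDerivAt_fst (hrev t ht)) (fun t ht => hasDerivAt_snd (hrev t ht))
    (fun t ht => (hmem t ht).2.2.1) (fun t ht => (hmem t ht).2.2.2)
    (fun t ht => abs_le.2 ⟨hlt.le.trans (hge t ht), (hmem t ht).2.1⟩)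
    (by rw [hγ0]) (by rw [hγ0]) hret.snd_eq
  have h1 : (-(γ h).1) ^ 4 < s ^ 4 :=
    pow_lt_pow_left₀ (by linarith) (by linarith [hret.fst_neg]) (by norm_num)
  rw [Even.neg_pow (by decide)] at h1
  linarith

lemma IsBarrier.continuousOn_returnTime (hB : IsBarrier b a M R Y) {ψ : ℝ × ℝ → ℝ → ℝ × ℝ}
    (hψ0 : ∀ p, ψ p 0 = p) (hψ : ∀ p t, HasDerivAt (ψ p) (clipField b R (ψ p t)) t)
    (hψc : Continuous fun q : (ℝ × ℝ) × ℝ => ψ q.1 q.2) {H : ℝ → ℝ}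
    (hH : ∀ s ∈ Set.Ioc 0 a, IsFirstReturn (ψ (s, 0)) (H s)) : ContinuousOn H (Set.Ioc 0 a) := by
  intro s₁ hs₁
  have hret := hH s₁ hs₁
  have hc2 : Continuous fun q : ℝ × ℝ => ψ (q.1, 0) q.2 :=
    hψc.comp ((continuous_fst.prodMk continuous_const).prodMk continuous_snd)
  rw [ContinuousWithinAt, tendsto_order]
  constructor
  · intro c hc
    have hopen : ∀ t ∈ Set.Icc 0 c, ∀ᶠ q : ℝ × ℝ in 𝓝 (s₁, t),
        0 < (ψ (q.1, 0) q.2).2 ∨ 0 < (ψ (q.1, 0) q.2).1 := by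
      intro t ht
      refine ((isOpen_lt continuous_const hc2.snd).union
        (isOpen_lt continuous_const hc2.fst)).mem_nhds ?_
      rcases ht.1.eq_or_lt with h0 | h0
      · right
        simp [← h0, hψ0, hs₁.1]
      · exact Or.inl (hret.snd_pos t ⟨h0, ht.2.trans_lt hc⟩)
    have hev := isCompact_Icc.eventually_forall_of_forall_eventually
      (P := fun s t => 0 < (ψ (s, 0) t).2 ∨ 0 < (ψ (s, 0) t).1) hopen
    filter_upwards [nhdsWithin_le_nhds hev, self_mem_nhdsWithin] with s hs hsmem
    have hr := hH s hsmem
    by_contra! hle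
    have := hs (H s) ⟨hr.pos.le, hle⟩
    rw [hr.snd_eq] at this
    have := hr.fst_neg
    simp_all only [lt_self_iff_false, false_or]
    linarith
  · intro c hc
    have hd := hasDerivAt_snd (hB.hasDerivAt_revField hs₁.1 hs₁.2 (hψ (s₁, 0)) (hψ0 _) hret.pos
      hret.snd_pos (Set.right_mem_Icc.2 hret.pos.le))
    have hev := eventually_nhdsWithin_sign_eq_of_deriv_neg
      (by rw [hd.deriv]
          simpa [revField, hret.snd_eq] using Odd.pow_neg (by decide : Odd 3) hret.fst_neg)
      hret.snd_eq
    obtain ⟨ε, hε, hball⟩ := Metric.eventually_nhds_iff.1 hev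
    obtain ⟨t, ht1, ht2⟩ := exists_between (lt_min hc (lt_add_of_pos_right (H s₁) hε))
    have h1 := (lt_min_iff.1 ht2).1
    have h2 := (lt_min_iff.1 ht2).2
    have hneg := hball (y := t) (by rw [Real.dist_eq, abs_sub_lt_iff]; constructor <;> linarith)
    rw [sign_neg (by linarith : H s₁ - t < 0), sign_eq_neg_one_iff] at hneg
    have hopen : ∀ᶠ s in 𝓝 s₁, (ψ (s, 0) t).2 < 0 :=
      (isOpen_lt (hc2.comp (continuous_id.prodMk continuous_const)).snd continuous_const).mem_nhds
        hneg
    filter_upwards [nhdsWithin_le_nhds hopen, self_mem_nhdsWithin] with s hs hsmem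
    have hr := hH s hsmem
    by_contra! hle
    have ht0 : 0 < t := hret.pos.trans ht1
    linarith [hr.snd_pos t ⟨ht0, h1.trans_le hle⟩]

lemma IsBarrier.exists_fst_eq_neg (hB : IsBarrier b a M R Y) (hb : 0 < b) (ha : 0 < a)
    {ψ : ℝ × ℝ → ℝ → ℝ × ℝ}
    (hψ0 : ∀ p, ψ p 0 = p) (hψ : ∀ p t, HasDerivAt (ψ p) (clipField b R (ψ p t)) t)
    (hψc : Continuous fun q : (ℝ × ℝ) × ℝ => ψ q.1 q.2) :
    ∃ s ∈ Set.Ioc 0 a, ∃ h, IsFirstReturn (ψ (s, 0)) h ∧ (ψ (s, 0) h).1 = -s := by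
  have hex : ∀ s : ℝ, ∃ h, s ∈ Set.Ioc 0 a → IsFirstReturn (ψ (s, 0)) h := fun s => by
    by_cases hs : s ∈ Set.Ioc 0 a
    · obtain ⟨h, hh⟩ := hB.exists_isFirstReturn hb hs.1 hs.2 (hψ (s, 0)) (hψ0 _)
      exact ⟨h, fun _ => hh⟩
    · exact ⟨0, fun h => absurd h hs⟩
  choose H hH using hex
  have hM : 0 < M := (hB.isOrbitGraph a (by linarith)).1.trans_le
    (hB.le_bound a (by linarith) le_rfl)
  obtain ⟨s₀, hs₀, hs₀a, hs₀b, hs₀M⟩ : ∃ s₀, 0 < s₀ ∧ s₀ ≤ a ∧ s₀ ^ 2 ≤ b / 12 ∧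
      s₀ * M ≤ 1 / 12 := by
    refine ⟨min a (min √(b / 12) (1 / 12 / M)), by positivity, min_le_left _ _, ?_, ?_⟩
    · rw [← Real.le_sqrt' (by positivity)]
      exact (min_le_right _ _).trans (min_le_left _ _)
    · rw [← le_div_iff₀ hM]
      exact (min_le_right _ _).trans (min_le_right _ _)
  have hHc := hB.continuousOn_returnTime hψ0 hψ hψc hH
  have hsub : Set.Icc s₀ a ⊆ Set.Ioc 0 a := fun s hs => ⟨hs₀.trans_le hs.1, hs.2⟩
  have hPc : ContinuousOn (fun s => (ψ (s, 0) (H s)).1 + s) (Set.Icc s₀ a) := by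
    refine ContinuousOn.add ?_ continuousOn_id
    exact (hψc.comp_continuousOn ((continuousOn_id.prodMk continuousOn_const).prodMk
      (hHc.mono hsub))).fst
  obtain ⟨s, hs, hs0⟩ := intermediate_value_Icc hs₀a hPc (show (0 : ℝ) ∈ _ by
    have h0 := hsub (Set.left_mem_Icc.2 hs₀a)
    have h1 := hsub (Set.right_mem_Icc.2 hs₀a)
    constructor
    · linarith [hB.le_neg_of_small h0.1 h0.2 hs₀b hs₀M (hψ _) (hψ0 _) (hH s₀ h0)]
    · linarith [hB.le_of_isFirstReturn h1.1 h1.2 (hψ _) (hψ0 _) (hH a h1)])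
  exact ⟨s, hsub hs, H s, hH s (hsub hs), by simp only at hs0; linarith⟩

lemma IsBarrier.exists_periodic (hB : IsBarrier b a M R Y) (hb : 0 < b) (ha : 0 < a) :
    ∃ γ : ℝ → ℝ × ℝ, (∀ t, HasDerivAt γ (revField b (γ t)) t) ∧
      ∃ h > 0, γ 0 ≠ 0 ∧ ∀ t, γ (t + h) = -γ t := by
  have hR : 0 ≤ R := by linarith [hB.le_radius]
  obtain ⟨K, hK⟩ := exists_lipschitzWith_clipField b hR
  obtain ⟨L, hL⟩ := exists_norm_clipField_le b hR
  obtain ⟨ψ, hψ0, hψ, hψc⟩ := exists_continuous_flow hK hL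
  obtain ⟨s, hs, h, hret, hfix⟩ := hB.exists_fst_eq_neg hb ha hψ0 hψ hψc
  have hsymm : ∀ t, ψ (s, 0) (t + h) = -ψ (s, 0) t := by
    refine congrFun (eq_of_hasDerivAt_of_lipschitzWith hK (t₀ := 0)
      (γ := fun t => ψ (s, 0) (t + h)) (δ := fun t => -ψ (s, 0) t)
      (fun t => (hψ (s, 0) (t + h)).comp_add_const t h) (fun t => ?_) ?_)
    · rw [clipField_neg hR]
      exact (hψ (s, 0) t).fun_neg
    · simp only [zero_add, hψ0]
      exact Prod.ext hfix (by simpa using hret.snd_eq)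
  have hnorm : ∀ t, ‖ψ (s, 0) t‖ ≤ R := by
    have hper : Function.Periodic (fun t => ‖ψ (s, 0) t‖) h := fun t => by
      simp only [hsymm, norm_neg]
    intro t
    obtain ⟨u, hu, heq⟩ := hper.exists_mem_Ico₀ hret.pos t
    obtain ⟨h1, h2, h3, h4⟩ := hB.isOrbitGraph.mem_of_clipField hB.tendsto hB.le_bound hB.le_radius
      hB.bound_le_radius hs.1 hs.2 (hψ (s, 0)) (hψ0 _) hret.pos hret.snd_pos u ⟨hu.1, hu.2.le⟩
    have := hB.le_radius
    have := hB.bound_le_radius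
    have := hs.2
    rw [heq, Prod.norm_def, Real.norm_eq_abs, Real.norm_eq_abs]
    exact max_le (abs_le.2 ⟨by linarith, by linarith⟩) (abs_le.2 ⟨by linarith, by linarith⟩)
  refine ⟨ψ (s, 0), fun t => ?_, h, hret.pos, ?_, hsymm⟩
  · have key := hψ (s, 0) t
    rwa [clipField_of_mem (abs_le.1 ((norm_fst_le _).trans (hnorm t)))
      (abs_le.1 ((norm_snd_le _).trans (hnorm t)))] at key
  · rw [hψ0]
    exact fun h0 => hs.1.ne' (congrArg Prod.fst h0)

end Return

lemma IsOrbitGraph.exists_bound {b a : ℝ} {Y : ℝ → ℝ} (hY : IsOrbitGraph b a Y)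
    (hlim : Tendsto Y (𝓝[>] (-a)) (𝓝 0)) : ∃ M, ∀ x, -a < x → x ≤ a → Y x ≤ M := by
  obtain ⟨c, hc, hsub⟩ := mem_nhdsGT_iff_exists_Ioo_subset.1
    (hlim.eventually (eventually_lt_nhds one_pos))
  obtain ⟨d, hd1, hd2⟩ := exists_between (Set.mem_Ioi.1 hc)
  have hcont : ContinuousOn Y (Set.Icc d a) := fun x hx =>
    (hY x (hd1.trans_le hx.1)).2.continuousAt.continuousWithinAt
  obtain ⟨M, hM⟩ := isCompact_Icc.exists_bound_of_continuousOn hcont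
  refine ⟨max 1 M, fun x hx1 hx2 => ?_⟩
  rcases lt_or_ge x d with hlt | hge
  · exact (hsub ⟨hx1, hlt.trans hd2⟩).le.trans (le_max_left _ _)
  · exact ((le_abs_self _).trans (hM x ⟨hge, hx2⟩)).trans (le_max_right _ _)

lemma IsOrbitGraph.exists_isPeriodicSol {α a : ℝ} {Y : ℝ → ℝ} (hα : α < 0) (ha : 0 < a)
    (hY : IsOrbitGraph (-α) a Y) (hlim : Tendsto Y (𝓝[>] (-a)) (𝓝 0)) :
    ∃ x y : ℝ → ℝ, IsSolXY α x y ∧ IsPeriodicSol x y ∧ NonconstSol x y := by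
  obtain ⟨M, hM⟩ := hY.exists_bound hlim
  have hB : IsBarrier (-α) a M (max a M) Y := ⟨hY, hlim, hM, le_max_left _ _, le_max_right _ _⟩
  obtain ⟨γ, hγ, h, hh, h0, hsymm⟩ := hB.exists_periodic (by linarith) ha
  have hper : ∀ t, γ (-(t + 2 * h)) = γ (-t) := fun t => by
    rw [← neg_neg (γ (-(t + 2 * h))), ← hsymm, ← hsymm]
    congr 1
    ring
  refine ⟨fun t => (γ (-t)).1, fun t => (γ (-t)).2, fun t => ?_, ⟨2 * h, by linarith, fun t => ?_⟩,
    0, -h, ?_⟩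
  · have hd : HasDerivAt (fun t => γ (-t)) (-revField (-α) (γ (-t))) t := by
      simpa [Function.comp_def] using (hγ (-t)).scomp t (hasDerivAt_neg t)
    refine ⟨(hasDerivAt_fst hd).congr_deriv ?_, (hasDerivAt_snd hd).congr_deriv ?_⟩
    · simp [revField]
    · simp only [revField, Prod.snd_neg]
      ring
  · simp only [hper, and_self]
  · intro heq
    have h1 : γ 0 = γ h := by simpa using heq
    have h2 := hsymm 0
    rw [zero_add, ← h1] at h2
    exact h0 (self_eq_neg.1 h2)

lemma exists_isOrbitGraph_of_image_eq {b a : ℝ} {U : Set ℝ} {X Y : ℝ → ℝ} (hUo : IsOpen U)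
    (hmono : StrictMonoOn X U) (himg : X '' U = Set.Ioi (-a)) (hpos : ∀ τ ∈ U, 0 < Y τ)
    (hX : ∀ τ ∈ U, HasDerivAt X (1 / Y τ) τ)
    (hY : ∀ τ ∈ U, HasDerivAt Y ((-X τ ^ 3 - b * X τ ^ 2 * Y τ + Y τ ^ 3) / Y τ ^ 2) τ) :
    ∃ G, IsOrbitGraph b a G ∧ ∀ τ ∈ U, G (X τ) = Y τ := by
  set I := Function.invFunOn X U
  have hmem : ∀ x, -a < x → I x ∈ U := fun x hx =>
    Function.invFunOn_mem (by rwa [← Set.mem_image, himg])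
  have heq : ∀ x, -a < x → X (I x) = x := fun x hx =>
    Function.invFunOn_eq (by rwa [← Set.mem_image, himg])
  have hleft : ∀ τ ∈ U, I (X τ) = τ := fun τ hτ =>
    hmono.injOn.leftInvOn_invFunOn hτ
  have hXmem : ∀ τ ∈ U, -a < X τ := fun τ hτ => by
    rw [← Set.mem_Ioi, ← himg]
    exact Set.mem_image_of_mem X hτ
  have hImono : StrictMonoOn I (Set.Ioi (-a)) := fun x hx y hy hxy =>
    (hmono.lt_iff_lt (hmem x hx) (hmem y hy)).1 (by rwa [heq x hx, heq y hy])
  have hIimg : I '' Set.Ioi (-a) = U := by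
    ext τ
    refine ⟨?_, fun hτ => ⟨X τ, hXmem τ hτ, hleft τ hτ⟩⟩
    rintro ⟨x, hx, rfl⟩
    exact hmem x hx
  refine ⟨fun x => Y (I x), fun x hx => ⟨hpos _ (hmem x hx), ?_⟩, fun τ hτ => by
    simp only [hleft τ hτ]⟩
  have hIc : ContinuousAt I x := hImono.continuousAt_of_image_mem_nhds (Ioi_mem_nhds hx)
    (by rw [hIimg]; exact hUo.mem_nhds (hmem x hx))
  have hY0 := (hpos _ (hmem x hx)).ne'
  have hId : HasDerivAt I (1 / Y (I x))⁻¹ x :=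
    (hX _ (hmem x hx)).of_local_left_inverse hIc (by positivity)
      (by filter_upwards [Ioi_mem_nhds hx] with y hy using heq y hy)
  refine ((hY _ (hmem x hx)).comp x hId).congr_deriv ?_
  rw [heq x hx]
  field_simp

/-- The change of variables `x = v / z`, `y = 1 / z` turns an orbit of the transformed system that
joins `v = -∞` to a point `(v₃, 0)` with `v₃ > 0` into an orbit graph over a half-line. -/
lemma exists_isOrbitGraph_of_separatrix {α v₃ : ℝ} (hv₃ : 0 < v₃) {T : EReal} (hT : T ≠ ⊤)
    {v z : ℝ → ℝ}
    (hsol : ∀ τ : ℝ, T < (τ : EReal) →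
      HasDerivAt v (v τ * fcubic (v τ) α + (z τ) ^ 2) τ ∧
      HasDerivAt z (z τ * fcubic (v τ) α) τ ∧ 0 < z τ)
    (hfwd : Tendsto (fun τ => (v τ, z τ)) atTop (𝓝 (v₃, 0)))
    (hbwd : Tendsto v (Filter.comap (fun τ : ℝ => (τ : EReal)) (𝓝[>] T)) atBot) :
    ∃ a > 0, ∃ G, IsOrbitGraph (-α) a G ∧ Tendsto G (𝓝[>] (-a)) (𝓝 0) := by
  set U : Set ℝ := {τ | T < (τ : EReal)} with hU
  have hUo : IsOpen U := isOpen_Ioi.preimage continuous_coe_real_ereal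
  have hup : ∀ {σ τ : ℝ}, σ ∈ U → σ ≤ τ → τ ∈ U := fun hσ hστ =>
    lt_of_lt_of_le hσ (EReal.coe_le_coe_iff.2 hστ)
  have hUc : Convex ℝ U := Set.OrdConnected.convex ⟨fun _ hσ _ _ _ hu => hup hσ hu.1⟩
  have hbelow : ∀ N : ℝ, ∃ c ∈ U, ∀ τ ∈ U, τ ≤ c → v τ < N := by
    intro N
    have hev := eventually_comap.1 (hbwd.eventually (eventually_lt_atBot N))
    obtain ⟨u, hu, hsub⟩ := (mem_nhdsGT_iff_exists_Ioo_subset' (lt_top_iff_ne_top.2 hT)).1 hev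
    obtain ⟨c, hc1, hc2⟩ := EReal.lt_iff_exists_real_btwn.1 (Set.mem_Ioi.1 hu)
    exact ⟨c, hc1, fun τ hτ hτc =>
      hsub ⟨hτ, (EReal.coe_le_coe_iff.2 hτc).trans_lt hc2⟩ τ rfl⟩
  set X : ℝ → ℝ := fun τ => v τ / z τ with hXdef
  set Y : ℝ → ℝ := fun τ => 1 / z τ with hYdef
  have hYpos : ∀ τ ∈ U, 0 < Y τ := fun τ hτ => one_div_pos.2 (hsol τ hτ).2.2
  have hXY : ∀ τ, X τ = v τ * Y τ := fun τ => div_eq_mul_one_div _ _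
  have hXd : ∀ τ ∈ U, HasDerivAt X (1 / Y τ) τ := by
    intro τ hτ
    obtain ⟨h1, h2, h3⟩ := hsol τ hτ
    refine (h1.div h2 h3.ne').congr_deriv ?_
    simp only [hYdef]
    field_simp
    ring
  have hYd : ∀ τ ∈ U, HasDerivAt Y ((-X τ ^ 3 - -α * X τ ^ 2 * Y τ + Y τ ^ 3) / Y τ ^ 2) τ := by
    intro τ hτ
    obtain ⟨h1, h2, h3⟩ := hsol τ hτ
    refine ((hasDerivAt_const τ (1 : ℝ)).div h2 h3.ne').congr_deriv ?_
    simp only [hXdef, hYdef, fcubic]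
    field_simp
    ring
  have hmono : StrictMonoOn X U := by
    refine strictMonoOn_of_deriv_pos hUc
      (fun τ hτ => (hXd τ hτ).continuousAt.continuousWithinAt) fun τ hτ => ?_
    have hτ' := interior_subset hτ
    rw [(hXd τ hτ').deriv]
    exact one_div_pos.2 (hYpos τ hτ')
  have hXtop : Tendsto X atTop atTop := by
    obtain ⟨c, hc, -⟩ := hbelow 0
    have hz : Tendsto z atTop (𝓝[>] 0) := tendsto_nhdsWithin_iff.2
      ⟨hfwd.snd_nhds, (eventually_ge_atTop c).mono fun τ hτ => (hsol τ (hup hc hτ)).2.2⟩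
    exact hfwd.fst_nhds.pos_mul_atTop hv₃ hz.inv_tendsto_nhdsGT_zero
  have hbdd : BddBelow (X '' U) := by
    obtain ⟨c, hc, hvc⟩ := hbelow (min 0 (2 * α))
    set C := 4 * (Y c ^ 2 + X c ^ 4 / 4) with hC
    have hC0 : 0 ≤ C := by positivity
    have hle : ∀ τ ∈ U, τ ≤ c → -(C + 1) ≤ X τ := by
      intro τ hτ hτc
      have key := le_of_forall_hasDerivAt_nonneg (f := fun u => Y u ^ 2 + X u ^ 4 / 4)
        (f' := fun u => Y u ^ 2 * (-v u ^ 3 + 2 * α * v u ^ 2 + 2)) hτc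
        (fun u hu => by
          have huU := hup hτ hu.1
          have h0 := (hYpos u huU).ne'
          refine (((hYd u huU).pow 2).fun_add (((hXd u huU).pow 4).div_const 4)).congr_deriv ?_
          rw [hXY u]
          field_simp
          push_cast
          ring)
        (fun u hu => by
          have hv := hvc u (hup hτ hu.1) hu.2
          have h1 := hv.trans_le (min_le_left _ _)
          have h2 := hv.trans_le (min_le_right _ _)
          have h3 : 0 ≤ v u ^ 2 * (2 * α - v u) := mul_nonneg (sq_nonneg _) (by linarith)
          exact mul_nonneg (sq_nonneg _) (by nlinarith))
      by_contra! hlt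
      have h1 : C + 1 < -X τ := by linarith
      have h2 : (C + 1) ^ 4 < (-X τ) ^ 4 := pow_lt_pow_left₀ h1 (by linarith) (by norm_num)
      rw [Even.neg_pow (by decide)] at h2
      have h3 : C + 1 ≤ (C + 1) ^ 4 := le_self_pow₀ (by linarith) (by norm_num)
      have h4 := sq_nonneg (Y τ)
      linarith
    refine ⟨-(C + 1), ?_⟩
    rintro _ ⟨τ, hτ, rfl⟩
    rcases le_total τ c with h | h
    · exact hle τ hτ h
    · exact (hle c hc le_rfl).trans (hmono.monotoneOn hc hτ h)
  set a := -sInf (X '' U) with ha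
  have ha0 : 0 < a := by
    obtain ⟨c, hc, hvc⟩ := hbelow 0
    have h1 : X c < 0 := div_neg_of_neg_of_pos (hvc c hc le_rfl) (hsol c hc).2.2
    have h2 := csInf_le hbdd (Set.mem_image_of_mem X hc)
    linarith
  have himg : X '' U = Set.Ioi (-a) := by
    rw [ha, neg_neg]
    ext x
    constructor
    · rintro ⟨τ, hτ, rfl⟩
      obtain ⟨σ, hσ1, hσ2⟩ := EReal.lt_iff_exists_real_btwn.1 (show T < (τ : EReal) from hτ)
      exact (csInf_le hbdd (Set.mem_image_of_mem X hσ1)).trans_lt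
        (hmono hσ1 hτ (EReal.coe_lt_coe_iff.1 hσ2))
    · intro hx
      obtain ⟨c, hc, -⟩ := hbelow 0
      obtain ⟨_, ⟨σ, hσ, rfl⟩, hσx⟩ := exists_lt_of_csInf_lt ⟨X c, Set.mem_image_of_mem X hc⟩ hx
      obtain ⟨τ, hτx, hτσ⟩ := ((hXtop.eventually_ge_atTop x).and (eventually_ge_atTop σ)).exists
      exact hUc.isPreconnected.intermediate_value hσ (hup hσ hτσ)
        (fun τ hτ => (hXd τ hτ).continuousAt.continuousWithinAt) ⟨hσx.le, hτx⟩
  obtain ⟨G, hG, hGX⟩ := exists_isOrbitGraph_of_image_eq hUo hmono himg hYpos hXd hYd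
  refine ⟨a, ha0, G, hG, tendsto_order.2 ⟨fun ε hε => ?_, fun ε hε => ?_⟩⟩
  · filter_upwards [self_mem_nhdsWithin] with x hx using hε.trans (hG x hx).1
  · obtain ⟨c, hc, hvc⟩ := hbelow (-(a / ε))
    have hXc : -a < X c := by
      rw [← Set.mem_Ioi, ← himg]
      exact Set.mem_image_of_mem X hc
    filter_upwards [Ioo_mem_nhdsGT hXc] with x hx
    obtain ⟨τ, hτ, rfl⟩ : x ∈ X '' U := by
      rw [himg]
      exact hx.1
    have h1 := hvc τ hτ ((hmono.lt_iff_lt hτ hc).1 hx.2).le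
    have h2 := hx.1
    rw [hXY] at h2
    rw [hGX τ hτ]
    have h3 : a / ε * Y τ < a / ε * ε := by
      rw [div_mul_cancel₀ a hε.ne']
      nlinarith [mul_lt_mul_of_pos_right h1 (hYpos τ hτ)]
    exact lt_of_mul_lt_mul_left h3 (by positivity)

lemma exists_pos_fcubic_eq_zero {α : ℝ} (hα : α < 0) : ∃ w > 0, fcubic w α = 0 := by
  have hc : ContinuousOn (fun w => fcubic w α) (Set.Icc 0 1) := by
    unfold fcubic
    fun_prop
  obtain ⟨w, hw, hw0⟩ := intermediate_value_Icc zero_le_one hc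
    (show (0 : ℝ) ∈ _ by constructor <;> norm_num [fcubic, hα.le])
  refine ⟨w, lt_of_le_of_ne hw.1 ?_, hw0⟩
  rintro rfl
  norm_num [fcubic] at hw0

/-- Let `α < -3·4^(-1/3)` and let `v₃` be the largest root of `f(·,α) = 0`.  If the
transformed system has a solution on `(T, +∞)` (with `T ∈ [-∞,∞)`), positive in `z`, tending
to `(v₃,0)` as `τ → +∞` and with `v(τ) → -∞` as `τ → T⁺`, then the system
`ẋ = y`, `ẏ = -x³ + αx²y + y³` has a nonconstant periodic solution (a limit cycle). -/
theorem limit_cycle_of_unbounded_separatrix (α : ℝ)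
    (hα : α < -3 * (4 : ℝ) ^ (-(1 : ℝ) / 3))
    (v₃ : ℝ) (hv₃ : fcubic v₃ α = 0 ∧ ∀ w : ℝ, fcubic w α = 0 → w ≤ v₃)
    (T : EReal) (hT : T ≠ ⊤) (v z : ℝ → ℝ)
    (hsol : ∀ τ : ℝ, T < (τ : EReal) →
      HasDerivAt v (v τ * fcubic (v τ) α + (z τ) ^ 2) τ ∧
      HasDerivAt z (z τ * fcubic (v τ) α) τ ∧ 0 < z τ)
    (hfwd : Tendsto (fun τ => (v τ, z τ)) atTop (𝓝 (v₃, 0)))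
    (hbwd : Tendsto v (Filter.comap (fun τ : ℝ => (τ : EReal)) (𝓝[>] T)) atBot) :
    ∃ x y : ℝ → ℝ, IsSolXY α x y ∧ IsPeriodicSol x y ∧ NonconstSol x y := by
  have hα0 : α < 0 := by
    have : (0 : ℝ) < 4 ^ (-(1 : ℝ) / 3) := by positivity
    linarith
  obtain ⟨w, hw, hw0⟩ := exists_pos_fcubic_eq_zero hα0
  obtain ⟨a, ha, G, hG, hlim⟩ :=
    exists_isOrbitGraph_of_separatrix (hw.trans_le (hv₃.2 w hw0)) hT hsol hfwd hbwd
  exact hG.exists_isPeriodicSol hα0 ha hlim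
end
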